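/- Let F be a finite union-closed family of finite subsets of a type α. Suppose there exist four pairwise distinct sets A₁, A₂, A₃, A₄ ∈ F, each of cardinality 3, such that |A₁ ∪ A₂ ∪ A₃ ∪ A₄| ≤ 7. Then F satisfies the Frankl condition (every uniform 734-family is an FC-family). -/

import Mathlib

open Finset

variable {α : Type*} [DecidableEq α]

/-- The union of all members of a family. -/
def famUnion (F : Finset (Finset α)) : Finset α := F.sup id

/-- A family is union-closed. -/
def unionClosed (F : Finset (Finset α)) : Prop :=
  ∀ A ∈ F, ∀ B ∈ F, A ∪ B ∈ F

/-- A family `F` is union-closed for a family `Fc`. -/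
def unionClosedFor (F Fc : Finset (Finset α)) : Prop :=
  unionClosed F ∧ ∀ A ∈ F, ∀ B ∈ Fc, A ∪ B ∈ F

/-- The closure of a family: all unions of nonempty subfamilies. -/
def ucClosure (F : Finset (Finset α)) : Finset (Finset α) :=
  (F.powerset.filter (fun G => G ≠ ∅)).image (fun G => G.sup id)

/-- The number of members of `F` containing `a`. -/
def cnt (a : α) (F : Finset (Finset α)) : ℕ := (F.filter (fun A => a ∈ A)).card

/-- The Frankl condition. -/
def frankl (F : Finset (Finset α)) : Prop :=
  ∃ a ∈ famUnion F, 2 * cnt a F ≥ F.card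

/-- `w` is a weight function on `X`. -/
def weightFunOn (w : α → ℕ) (X : Finset α) : Prop := ∃ a ∈ X, w a > 0

/-- The weight of a set. -/
def sw (w : α → ℕ) (A : Finset α) : ℕ := ∑ a ∈ A, w a

/-- The weight of a family. -/
def fw (w : α → ℕ) (F : Finset (Finset α)) : ℕ := ∑ A ∈ F, sw w A

/-- The share of a set w.r.t. `w` and `X` (an integer). -/
def ss (w : α → ℕ) (A X : Finset α) : ℤ := 2 * (sw w A : ℤ) - (sw w X : ℤ)

/-- The share of a family w.r.t. `w` and `X`. -/
def fs (w : α → ℕ) (F : Finset (Finset α)) (X : Finset α) : ℤ := ∑ A ∈ F, ss w A X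

/-- The `S`-hypercube with base `K`: sets sandwiched between `K` and `K ∪ S`. -/
def hc (K S : Finset α) : Finset (Finset α) :=
  (K ∪ S).powerset.filter (fun A => K ⊆ A)

/-- The hyper-share of a family. -/
def hs (K S : Finset α) (F : Finset (Finset α)) (w : α → ℕ) (X : Finset α) : ℤ :=
  ∑ A ∈ hc K S ∩ F, ss w A X

/-- The projection of a family onto a hypercube. -/
def hcprj (K S : Finset α) (F : Finset (Finset α)) : Finset (Finset α) :=
  (hc K S ∩ F).image (fun A => A \ K)

/-- Union-closed extensions of `Fc`. -/
def uce (Fc F' : Finset (Finset α)) : Prop :=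
  (∀ A ∈ F', A ⊆ famUnion Fc) ∧ unionClosedFor F' Fc

namespace FC734

/-- Certificate trees: leaves carry transfer arcs, inner nodes branch on membership of a set. -/
inductive Ct where
  | L (arcs : List ℕ) : Ct
  | N (a : ℕ) (i e : Ct) : Ct

/-- Binary tries storing integer coefficients. -/
inductive Tr where
  | lf (v : ℤ) : Tr
  | nd (l r : Tr) : Tr

def Tr.add : Tr → ℕ → ℤ → Tr
  | .lf v, _, t => .lf (v + t)
  | .nd l r, p, t => bif Nat.beq (p % 2) 0 then .nd (l.add (p / 2) t) r else .nd l (r.add (p / 2) t)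

def Tr.perf : Tr → ℕ → Prop
  | .lf _, n => n = 0
  | .nd l r, n => ∃ k, n = k + 1 ∧ l.perf k ∧ r.perf k

def Tr.val (x : ℕ → ℤ) : Tr → ℕ → ℕ → ℤ
  | .lf v, o, _ => v * x o
  | .nd l r, o, k => l.val x o (2 * k) + r.val x (o + k) (2 * k)

def Tr.lb (I E : ℕ) : Tr → ℕ → ℕ → ℤ
  | .lf v, o, _ => bif I.testBit o then v else bif E.testBit o then 0 else (if 0 ≤ v then 0 else v)
  | .nd l r, o, k => l.lb I E o (2 * k) + r.lb I E (o + k) (2 * k)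

def bld : List ℕ → ℤ → Tr
  | [], v => .lf v
  | w :: ws, v => .nd (bld ws (v - w)) (bld ws (v + w))

def shU (A G : ℕ) : ℕ :=
  (List.range 128).foldr (fun D r => bif G.testBit D then 2 ^ (A ||| D) ||| r else r) 0

def arcOk (J n : ℕ) : Bool := J.testBit (n / 32 % 128) && Nat.blt (n / 4096) 128

def arcApp (s : Tr) (n : ℕ) : Tr :=
  (s.add (n / 4096) ((n % 32 : ℕ) : ℤ)).add ((n / 4096) ||| (n / 32 % 128)) (-((n % 32 : ℕ) : ℤ))

def chk (U : ℕ) (s : Tr) : Ct → ℕ → ℕ → Bool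
  | .L arcs, I, E => (!(Nat.beq (I &&& E) 0)) ||
      (arcs.all (arcOk (I ||| U)) && decide (0 ≤ (arcs.foldl arcApp s).lb I E 0 1))
  | .N a i e, I, E => chk U s i (I ||| shU a (I ||| U)) E && chk U s e I (E ||| 2 ^ a)

def mkU : List ℕ → ℕ
  | [] => 1
  | c :: cs => mkU cs ||| shU c (mkU cs)

def supp (c : List ℕ) : ℕ := c.foldr (fun a b => a ||| b) 0

/-- masks not contained in `S` -/
def outE (S : ℕ) : ℕ :=
  (List.range 128).foldr (fun D r => bif Nat.beq (D ||| S) S then r else 2 ^ D ||| r) 0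

def chkCfg (c ws : List ℕ) (t : Ct) : Bool :=
  Nat.beq ws.length 7 && Nat.blt 0 ws.sum && chk (mkU c) (bld ws 0) t 0 (outE (supp c))

def pim (c i : ℕ) : ℕ := c / 8 ^ i % 8

def act (c m : ℕ) : ℕ :=
  (List.range 7).foldr (fun i r => bif m.testBit i then 2 ^ (pim c i) ||| r else r) 0

def T3 : List ℕ := [7, 11, 13, 14, 19, 21, 22, 25, 26, 28, 35, 37, 38, 41, 42, 44, 49, 50, 52, 56,
  67, 69, 70, 73, 74, 76, 81, 82, 84, 88, 97, 98, 100, 104, 112]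

def memb (m : ℕ) (L : List ℕ) : Bool := L.any (Nat.beq m)

def chkStep (L : List ℕ) (targets : List (List ℕ)) (tab : List ℕ) : Bool :=
  Nat.beq tab.length 35 &&
  (T3.zip tab).all fun mp =>
    memb mp.1 L || (Nat.beq (act mp.2 127) 127 &&
      targets.any fun t => t.all fun a => memb a ((mp.1 :: L).map (act mp.2)))

theorem Tr.add_perf (t : ℤ) : ∀ (s : Tr) (n p : ℕ), s.perf n → (s.add p t).perf n
  | .lf v, n, p, h => by simpa [Tr.add, Tr.perf] using h
  | .nd l r, n, p, h => by
      obtain ⟨k, hk, hl, hr⟩ := h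
      have h1 := Tr.add_perf t l k (p / 2) hl
      have h2 := Tr.add_perf t r k (p / 2) hr
      unfold Tr.add
      cases Nat.beq (p % 2) 0
      · exact ⟨k, hk, hl, h2⟩
      · exact ⟨k, hk, h1, hr⟩

theorem Tr.add_val (x : ℕ → ℤ) (t : ℤ) : ∀ (s : Tr) (n p o k : ℕ), s.perf n → p < 2 ^ n →
    (s.add p t).val x o k = s.val x o k + t * x (o + k * p)
  | .lf v, n, p, o, k, h, hp => by
      have hn : n = 0 := h
      subst hn
      have : p = 0 := by simpa using hp
      subst this
      simp [Tr.add, Tr.val]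
      ring
  | .nd l r, n, p, o, k, h, hp => by
      obtain ⟨m, hk, hl, hr⟩ := h
      subst hk
      have hp2 : p / 2 < 2 ^ m := by
        rw [pow_succ] at hp; omega
      have h1 := Tr.add_val x t l m (p / 2) o (2 * k) hl hp2
      have h2 := Tr.add_val x t r m (p / 2) (o + k) (2 * k) hr hp2
      unfold Tr.add
      rcases Nat.mod_two_eq_zero_or_one p with h0 | h0
      · have e : o + 2 * k * (p / 2) = o + k * p := by
          have : p = 2 * (p / 2) := by omega
          conv_rhs => rw [this]
          ring
        rw [e] at h1
        rw [h0]
        simp only [Nat.beq, cond_true, Tr.val, h1]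
        ring
      · have e : o + k + 2 * k * (p / 2) = o + k * p := by
          have : p = 2 * (p / 2) + 1 := by omega
          conv_rhs => rw [this]
          ring
        rw [e] at h2
        rw [h0]
        simp only [Nat.beq, cond_false, Tr.val, h2]
        ring

theorem Tr.lb_le (G : Finset ℕ) (I E : ℕ) (hI : ∀ a, I.testBit a = true → a ∈ G)
    (hE : ∀ a, E.testBit a = true → a ∉ G) : ∀ (s : Tr) (o k : ℕ),
    s.lb I E o k ≤ s.val (fun a => if a ∈ G then 1 else 0) o k
  | .lf v, o, k => by
      simp only [Tr.lb, Tr.val]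
      cases h1 : I.testBit o
      · cases h2 : E.testBit o
        · simp only [cond_false]
          split_ifs <;> omega
        · simp [hE o h2]
      · simp [hI o h1]
  | .nd l r, o, k => by
      have h1 := Tr.lb_le G I E hI hE l o (2 * k)
      have h2 := Tr.lb_le G I E hI hE r (o + k) (2 * k)
      simp only [Tr.lb, Tr.val]
      omega

theorem bld_perf : ∀ (ws : List ℕ) (v : ℤ), (bld ws v).perf ws.length
  | [], v => rfl
  | w :: ws, v => ⟨ws.length, by simp, bld_perf ws _, bld_perf ws _⟩

def shareL : List ℕ → ℕ → ℤ
  | [], _ => 0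
  | w :: ws, p => (if p % 2 = 0 then -(w : ℤ) else w) + shareL ws (p / 2)

theorem sum_even_odd (f : ℕ → ℤ) : ∀ n, ∑ p ∈ Finset.range (2 * n), f p =
    ∑ p ∈ Finset.range n, f (2 * p) + ∑ p ∈ Finset.range n, f (2 * p + 1)
  | 0 => by simp
  | n + 1 => by
      rw [show 2 * (n + 1) = 2 * n + 1 + 1 by ring, Finset.sum_range_succ, Finset.sum_range_succ,
        sum_even_odd f n, Finset.sum_range_succ, Finset.sum_range_succ]
      ring

theorem bld_val (x : ℕ → ℤ) : ∀ (ws : List ℕ) (v : ℤ) (o k : ℕ),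
    (bld ws v).val x o k = ∑ p ∈ Finset.range (2 ^ ws.length), (v + shareL ws p) * x (o + k * p)
  | [], v, o, k => by simp [bld, Tr.val, shareL]
  | w :: ws, v, o, k => by
      have e : 2 ^ (w :: ws).length = 2 * 2 ^ ws.length := by
        rw [List.length_cons, pow_succ]; ring
      rw [e, sum_even_odd]
      simp only [bld, Tr.val]
      rw [bld_val x ws, bld_val x ws]
      congr 1
      · apply Finset.sum_congr rfl
        intro p _
        have h1 : 2 * p % 2 = 0 := by omega
        have h2 : 2 * p / 2 = p := by omega
        simp only [shareL, h1, h2, if_true]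
        rw [show o + 2 * k * p = o + k * (2 * p) by ring]
        ring
      · apply Finset.sum_congr rfl
        intro p _
        have h1 : ¬ ((2 * p + 1) % 2 = 0) := by omega
        have h2 : (2 * p + 1) / 2 = p := by omega
        simp only [shareL, h1, h2, if_false]
        rw [show o + k + 2 * k * p = o + k * (2 * p + 1) by ring]
        ring

theorem shareL_eq : ∀ (ws : List ℕ) (p : ℕ), shareL ws p + (ws.sum : ℤ) =
    2 * ∑ i ∈ Finset.range ws.length, if p.testBit i = true then ((ws.getD i 0 : ℕ) : ℤ) else 0
  | [], p => by simp [shareL]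
  | w :: ws, p => by
      have ih := shareL_eq ws (p / 2)
      rw [List.length_cons, Finset.sum_range_succ']
      simp only [Nat.testBit_succ, List.getD_cons_succ, List.getD_cons_zero, List.sum_cons, shareL,
        Nat.testBit_zero, decide_eq_true_eq]
      rw [mul_add, ← ih, Nat.cast_add]
      rcases Nat.mod_two_eq_zero_or_one p with h | h
      · rw [if_pos h, if_neg (by omega)]
        ring
      · rw [if_neg (by omega), if_pos h]
        ring

theorem sum_getD : ∀ (ws : List ℕ), ∑ i ∈ Finset.range ws.length, ws.getD i 0 = ws.sum
  | [] => by simp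
  | w :: ws => by
      rw [List.length_cons, Finset.sum_range_succ']
      simp only [List.getD_cons_succ, List.getD_cons_zero, List.sum_cons, sum_getD ws]
      ring

theorem testBit_foldr (L : List ℕ) (q : ℕ → Bool) (f : ℕ → ℕ) (j : ℕ) :
    (L.foldr (fun D r => bif q D then 2 ^ (f D) ||| r else r) 0).testBit j = true ↔
      ∃ D ∈ L, q D = true ∧ f D = j := by
  induction L with
  | nil => simp
  | cons a L ih =>
      rw [List.foldr_cons]
      cases h : q a
      · simp [h, ih]
      · simp only [cond_true, Nat.testBit_or, Bool.or_eq_true, ih, Nat.testBit_two_pow,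
          decide_eq_true_eq, List.mem_cons]
        constructor
        · rintro (h1 | ⟨D, hD, h1⟩)
          · exact ⟨a, Or.inl rfl, h, h1⟩
          · exact ⟨D, Or.inr hD, h1⟩
        · rintro ⟨D, rfl | hD, h1, h2⟩
          · exact Or.inl h2
          · exact Or.inr ⟨D, hD, h1, h2⟩

theorem testBit_shU (A G j : ℕ) : (shU A G).testBit j = true ↔
    ∃ D < 128, G.testBit D = true ∧ A ||| D = j := by
  unfold shU
  rw [testBit_foldr]
  simp

theorem testBit_outE (S j : ℕ) (h : (outE S).testBit j = true) : j ||| S ≠ S := by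
  have e : outE S = (List.range 128).foldr
      (fun D r => bif !(Nat.beq (D ||| S) S) then 2 ^ (id D) ||| r else r) 0 := by
    unfold outE
    congr 1
    funext D r
    cases Nat.beq (D ||| S) S <;> rfl
  rw [e, testBit_foldr] at h
  obtain ⟨D, _, h1, h2⟩ := h
  simp only [id] at h2
  subst h2
  intro h3
  rw [h3] at h1
  simp at h1

theorem testBit_act (c m j : ℕ) : (act c m).testBit j = true ↔
    ∃ i < 7, m.testBit i = true ∧ pim c i = j := by
  unfold act
  rw [testBit_foldr]
  simp

theorem arcs_sound (G : Finset ℕ) (J : ℕ)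
    (hJ : ∀ D, J.testBit D = true → ∀ a ∈ G, a ||| D ∈ G) : ∀ (arcs : List ℕ) (s : Tr),
    s.perf 7 → arcs.all (arcOk J) = true →
    (arcs.foldl arcApp s).val (fun a => if a ∈ G then 1 else 0) 0 1 ≤
      s.val (fun a => if a ∈ G then 1 else 0) 0 1
  | [], s, hs, h => le_refl _
  | n :: arcs, s, hs, h => by
      simp only [List.all_cons, Bool.and_eq_true] at h
      obtain ⟨h1, h2⟩ := h
      simp only [arcOk, Bool.and_eq_true] at h1
      obtain ⟨h1, h3⟩ := h1
      have h3 : n / 4096 < 2 ^ 7 := by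
        have := Nat.le_of_ble_eq_true h3
        omega
      have h4 : n / 32 % 128 < 2 ^ 7 := by omega
      have hp : (arcApp s n).perf 7 := Tr.add_perf _ _ _ _ (Tr.add_perf _ _ _ _ hs)
      refine (arcs_sound G J hJ arcs (arcApp s n) hp h2).trans ?_
      unfold arcApp
      rw [Tr.add_val _ _ _ 7 _ _ _ (Tr.add_perf _ _ _ _ hs) (Nat.or_lt_two_pow h3 h4),
        Tr.add_val _ _ _ 7 _ _ _ hs h3]
      have h5 := hJ _ h1 (n / 4096)
      simp only [zero_add, one_mul]
      have ht : (0 : ℤ) ≤ ((n % 32 : ℕ) : ℤ) := by positivity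
      generalize ((n % 32 : ℕ) : ℤ) = t at ht ⊢
      by_cases ha : n / 4096 ∈ G
      · simp [ha, h5 ha]
      · simp only [ha, if_false]
        split_ifs <;> linarith

theorem chk_sound (G : Finset ℕ) (U : ℕ) (s : Tr) (hs : s.perf 7)
    (hG : ∀ a ∈ G, ∀ b ∈ G, a ||| b ∈ G)
    (hU : ∀ D, U.testBit D = true → ∀ a ∈ G, a ||| D ∈ G) : ∀ (t : Ct) (I E : ℕ),
    (∀ a, I.testBit a = true → a ∈ G) → (∀ a, E.testBit a = true → a ∉ G) →
    chk U s t I E = true → 0 ≤ s.val (fun a => if a ∈ G then 1 else 0) 0 1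
  | .L arcs, I, E, hI, hE, h => by
      have hJ : ∀ D, (I ||| U).testBit D = true → ∀ a ∈ G, a ||| D ∈ G := by
        intro D hD a ha
        rw [Nat.testBit_or, Bool.or_eq_true] at hD
        rcases hD with hD | hD
        · exact hG _ ha _ (hI _ hD)
        · exact hU _ hD _ ha
      simp only [chk, Bool.or_eq_true, Bool.and_eq_true, decide_eq_true_eq] at h
      rcases h with h | ⟨h1, h2⟩
      · exfalso
        have h0 : I &&& E = 0 := by
          apply Nat.eq_of_testBit_eq
          intro i
          rw [Nat.testBit_and, Nat.zero_testBit]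
          cases h1 : I.testBit i
          · rfl
          · cases h2 : E.testBit i
            · rfl
            · exact absurd (hI i h1) (hE i h2)
        rw [h0] at h
        simp at h
      · exact (h2.trans (Tr.lb_le G I E hI hE _ _ _)).trans (arcs_sound G _ hJ arcs s hs h1)
  | .N a i e, I, E, hI, hE, h => by
      simp only [chk, Bool.and_eq_true] at h
      by_cases ha : a ∈ G
      · refine chk_sound G U s hs hG hU i _ E ?_ hE h.1
        intro b hb
        rw [Nat.testBit_or, Bool.or_eq_true] at hb
        rcases hb with hb | hb
        · exact hI _ hb
        · rw [testBit_shU] at hb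
          obtain ⟨D, _, hD, rfl⟩ := hb
          rw [Nat.testBit_or, Bool.or_eq_true] at hD
          rcases hD with hD | hD
          · exact hG _ ha _ (hI _ hD)
          · exact hU _ hD _ ha
      · refine chk_sound G U s hs hG hU e I _ hI ?_ h.2
        intro b hb
        rw [Nat.testBit_or, Bool.or_eq_true] at hb
        rcases hb with hb | hb
        · exact hE _ hb
        · rw [Nat.testBit_two_pow, decide_eq_true_eq] at hb
          exact hb ▸ ha

theorem mkU_sound (G : Finset ℕ) : ∀ (c : List ℕ) (_ : ∀ m ∈ c, ∀ a ∈ G, a ||| m ∈ G) (D : ℕ),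
    (mkU c).testBit D = true → ∀ a ∈ G, a ||| D ∈ G
  | [], h, D, hD, a, ha => by
      have h1 : D = 0 := by
        have := (Nat.testBit_two_pow (n := 0) (m := D))
        simp only [mkU] at hD
        rw [pow_zero] at this
        rw [this] at hD
        exact (of_decide_eq_true hD).symm
      subst h1
      simpa using ha
  | m :: c, h, D, hD, a, ha => by
      have ih := mkU_sound G c (fun m' hm' => h m' (List.mem_cons_of_mem _ hm'))
      rw [mkU, Nat.testBit_or, Bool.or_eq_true] at hD
      rcases hD with hD | hD
      · exact ih D hD a ha
      · rw [testBit_shU] at hD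
        obtain ⟨D', _, hD, rfl⟩ := hD
        rw [← Nat.or_assoc]
        exact ih D' hD _ (h m List.mem_cons_self a ha)

/-- Main consequence of a successful check. -/
theorem chkCfg_sound (c ws : List ℕ) (t : Ct) (h : chkCfg c ws t = true) (G : Finset ℕ)
    (h128 : ∀ a ∈ G, a < 128)
    (hsupp : ∀ a ∈ G, a ||| supp c = supp c)
    (hG : ∀ a ∈ G, ∀ b ∈ G, a ||| b ∈ G) (hc : ∀ m ∈ c, ∀ a ∈ G, a ||| m ∈ G) :
    0 ≤ ∑ a ∈ G, shareL ws a := by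
  simp only [chkCfg, Bool.and_eq_true] at h
  obtain ⟨⟨h1, h2⟩, h3⟩ := h
  have h1 : ws.length = 7 := Nat.eq_of_beq_eq_true h1
  have hp : (bld ws 0).perf 7 := h1 ▸ bld_perf ws 0
  have := chk_sound G (mkU c) (bld ws 0) hp hG (mkU_sound G c hc) t 0 (outE (supp c))
    (by intro a ha; simp at ha) (fun a ha hb => testBit_outE _ _ ha (hsupp a hb)) h3
  rw [bld_val, h1] at this
  simp only [zero_add, one_mul, mul_ite, mul_one, mul_zero] at this
  rw [← Finset.sum_filter] at this
  have e : (Finset.range (2 ^ 7)).filter (fun a => a ∈ G) = G := by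
    ext a
    simp only [Finset.mem_filter, Finset.mem_range]
    exact ⟨fun h => h.2, fun h => ⟨h128 a h, h⟩⟩
  rwa [e] at this

def Rep {α : Type*} (e : α → ℕ) (A : Finset α) (m : ℕ) : Prop :=
  ∀ i, m.testBit i = true ↔ ∃ a ∈ A, e a = i

theorem exists_rep {α : Type*} [DecidableEq α] (e : α → ℕ) (A : Finset α) : ∃ m, Rep e A m := by
  induction A using Finset.induction_on with
  | empty => exact ⟨0, fun i => by simp⟩
  | insert a A ha ih =>
      obtain ⟨m, hm⟩ := ih
      refine ⟨2 ^ (e a) ||| m, fun i => ?_⟩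
      rw [Nat.testBit_or, Bool.or_eq_true, hm i, Nat.testBit_two_pow, decide_eq_true_eq]
      simp

theorem Rep.union {α : Type*} [DecidableEq α] {e : α → ℕ} {A B : Finset α} {m n : ℕ}
    (hA : Rep e A m) (hB : Rep e B n) : Rep e (A ∪ B) (m ||| n) := by
  intro i
  rw [Nat.testBit_or, Bool.or_eq_true, hA i, hB i]
  simp only [Finset.mem_union]
  constructor
  · rintro (⟨a, h1, h2⟩ | ⟨a, h1, h2⟩)
    · exact ⟨a, Or.inl h1, h2⟩
    · exact ⟨a, Or.inr h1, h2⟩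
  · rintro ⟨a, h1 | h1, h2⟩
    · exact Or.inl ⟨a, h1, h2⟩
    · exact Or.inr ⟨a, h1, h2⟩

theorem Rep.uniq {α : Type*} {e : α → ℕ} {A : Finset α} {m n : ℕ}
    (hA : Rep e A m) (hB : Rep e A n) : m = n := by
  apply Nat.eq_of_testBit_eq
  intro i
  rw [Bool.eq_iff_iff, hA i, hB i]

theorem Rep.sub {α : Type*} {e : α → ℕ} {X A B : Finset α} {m : ℕ}
    (hinj : Set.InjOn e X) (hAX : A ⊆ X) (hBX : B ⊆ X)
    (hA : Rep e A m) (hB : Rep e B m) : A ⊆ B := by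
  intro a ha
  obtain ⟨b, hb, hab⟩ := (hB (e a)).1 ((hA (e a)).2 ⟨a, ha, rfl⟩)
  have := hinj (Finset.mem_coe.2 (hBX hb)) (Finset.mem_coe.2 (hAX ha)) hab
  exact this ▸ hb

theorem Rep.inj {α : Type*} {e : α → ℕ} {X A B : Finset α} {m : ℕ}
    (hinj : Set.InjOn e X) (hAX : A ⊆ X) (hBX : B ⊆ X)
    (hA : Rep e A m) (hB : Rep e B m) : A = B :=
  Finset.Subset.antisymm (Rep.sub hinj hAX hBX hA hB) (Rep.sub hinj hBX hAX hB hA)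

theorem Rep.lt {α : Type*} {e : α → ℕ} {A : Finset α} {m : ℕ} (h7 : ∀ a ∈ A, e a < 7)
    (hA : Rep e A m) : m < 128 := by
  apply Nat.lt_pow_two_of_testBit (n := 7)
  intro i hi
  by_contra h
  rw [Bool.not_eq_false, hA i] at h
  obtain ⟨a, ha, rfl⟩ := h
  exact absurd (h7 a ha) (by omega)

theorem supp_testBit : ∀ (c : List ℕ) (i : ℕ), (supp c).testBit i = true ↔
    ∃ m ∈ c, m.testBit i = true
  | [], i => by simp [supp]
  | m :: c, i => by
      have ih := supp_testBit c i
      have e : supp (m :: c) = m ||| supp c := rfl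
      rw [e, Nat.testBit_or, Bool.or_eq_true, ih]
      simp

theorem frankl_of_cfg {α : Type*} [DecidableEq α] (c ws : List ℕ) (t : Ct)
    (hchk : chkCfg c ws t = true) (hcne : c ≠ []) (F : Finset (Finset α)) (huc : unionClosed F)
    (X : Finset α) (e : α → ℕ) (hinj : Set.InjOn e X) (h7 : ∀ a ∈ X, e a < 7)
    (hreal : ∀ m ∈ c, ∃ A ∈ F, A ⊆ X ∧ Rep e A m) : frankl F := by
  have hchk' := hchk
  simp only [chkCfg, Bool.and_eq_true] at hchk'
  have hlen : ws.length = 7 := Nat.eq_of_beq_eq_true hchk'.1.1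
  have hW : 0 < ws.sum := Nat.le_of_ble_eq_true hchk'.1.2
  have hFne : 0 < F.card := by
    obtain ⟨m, hm⟩ := List.exists_mem_of_ne_nil c hcne
    obtain ⟨A, hA, _⟩ := hreal m hm
    exact Finset.card_pos.2 ⟨A, hA⟩
  obtain ⟨X0, hX0⟩ : ∃ X0, X0 = X.filter (fun a => (supp c).testBit (e a) = true) := ⟨_, rfl⟩
  have hX0X : X0 ⊆ X := hX0 ▸ Finset.filter_subset _ _
  have hinj0 : Set.InjOn e X0 := hinj.mono (Finset.coe_subset.2 hX0X)
  have h70 : ∀ a ∈ X0, e a < 7 := fun a ha => h7 a (hX0X ha)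
  choose msk hmsk using exists_rep e
  -- the fibres
  have key : ∀ K : Finset α, 0 ≤ ∑ A ∈ F.filter (fun A => A \ X0 = K), shareL ws (msk (A ∩ X0)) := by
    intro K
    have hsi : ∑ A ∈ F.filter (fun A => A \ X0 = K), shareL ws (msk (A ∩ X0)) =
        ∑ a ∈ (F.filter (fun A => A \ X0 = K)).image (fun A => msk (A ∩ X0)), shareL ws a := by
      rw [Finset.sum_image]
      intro A hA B hB hAB
      simp only [Finset.coe_filter, Set.mem_ofPred_eq] at hA hB
      have hAB' : msk (A ∩ X0) = msk (B ∩ X0) := hAB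
      have h1 : A ∩ X0 = B ∩ X0 :=
        Rep.inj hinj0 Finset.inter_subset_right Finset.inter_subset_right (hmsk _)
          (hAB' ▸ hmsk (B ∩ X0))
      rw [← Finset.sdiff_union_inter A X0, ← Finset.sdiff_union_inter B X0, hA.2, hB.2, h1]
    rw [hsi]
    apply chkCfg_sound c ws t hchk
    · intro a ha
      obtain ⟨A, hA, rfl⟩ := Finset.mem_image.1 ha
      exact Rep.lt (fun a ha => h70 a (Finset.mem_inter.1 ha).2) (hmsk _)
    · intro a ha
      obtain ⟨A, hA, rfl⟩ := Finset.mem_image.1 ha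
      apply Nat.eq_of_testBit_eq
      intro i
      rw [Nat.testBit_or]
      cases h : (msk (A ∩ X0)).testBit i
      · rfl
      · rw [hmsk _ i] at h
        obtain ⟨a, ha, rfl⟩ := h
        have := (Finset.mem_inter.1 ha).2
        rw [hX0, Finset.mem_filter] at this
        rw [this.2]
        rfl
    · intro a ha b hb
      obtain ⟨A, hA, rfl⟩ := Finset.mem_image.1 ha
      obtain ⟨B, hB, rfl⟩ := Finset.mem_image.1 hb
      rw [Finset.mem_filter] at hA hB
      refine Finset.mem_image.2 ⟨A ∪ B, Finset.mem_filter.2 ⟨huc A hA.1 B hB.1, ?_⟩, ?_⟩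
      · rw [Finset.union_sdiff_distrib, hA.2, hB.2, Finset.union_self]
      · have := Rep.union (hmsk (A ∩ X0)) (hmsk (B ∩ X0))
        rw [← Finset.union_inter_distrib_right] at this
        exact Rep.uniq (hmsk _) this
    · intro m hm a ha
      obtain ⟨A, hA, rfl⟩ := Finset.mem_image.1 ha
      obtain ⟨C, hC, hCX, hCm⟩ := hreal m hm
      have hC0 : C ⊆ X0 := by
        intro a ha
        rw [hX0, Finset.mem_filter]
        exact ⟨hCX ha, (supp_testBit c _).2 ⟨m, hm, (hCm _).2 ⟨a, ha, rfl⟩⟩⟩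
      rw [Finset.mem_filter] at hA
      refine Finset.mem_image.2 ⟨A ∪ C, Finset.mem_filter.2 ⟨huc A hA.1 C hC, ?_⟩, ?_⟩
      · rw [Finset.union_sdiff_distrib, hA.2, Finset.sdiff_eq_empty_iff_subset.2 hC0,
          Finset.union_empty]
      · have := Rep.union (hmsk (A ∩ X0)) hCm
        have h1 : A ∩ X0 ∪ C = (A ∪ C) ∩ X0 := by
          rw [Finset.union_inter_distrib_right, Finset.inter_eq_left.2 hC0]
        rw [h1] at this
        exact Rep.uniq (hmsk _) this
  have htot : 0 ≤ ∑ A ∈ F, shareL ws (msk (A ∩ X0)) := by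
    rw [← Finset.sum_fiberwise_of_maps_to (s := F) (t := F.image (fun A => A \ X0))
      (g := fun A => A \ X0) (fun A hA => Finset.mem_image_of_mem _ hA)]
    exact Finset.sum_nonneg (fun K _ => key K)
  have hsh : ∀ A ∈ F, shareL ws (msk (A ∩ X0)) =
      2 * (∑ a ∈ X0, if a ∈ A then ((ws.getD (e a) 0 : ℕ) : ℤ) else 0) - (ws.sum : ℤ) := by
    intro A _
    have h1 := shareL_eq ws (msk (A ∩ X0))
    rw [hlen, ← Finset.sum_filter] at h1
    have h2 : (Finset.range 7).filter (fun i => (msk (A ∩ X0)).testBit i = true) =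
        (A ∩ X0).image e := by
      ext i
      rw [Finset.mem_filter, hmsk _ i, Finset.mem_image, Finset.mem_range]
      constructor
      · exact fun h => h.2
      · rintro ⟨a, ha, rfl⟩
        exact ⟨h70 a (Finset.mem_inter.1 ha).2, a, ha, rfl⟩
    rw [h2, Finset.sum_image (hinj0.mono (by simp))] at h1
    rw [← Finset.sum_filter, Finset.filter_mem_eq_inter, Finset.inter_comm X0 A]
    linarith
  rw [Finset.sum_congr rfl hsh, Finset.sum_sub_distrib, ← Finset.mul_sum, Finset.sum_comm,
    Finset.sum_const, nsmul_eq_mul] at htot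
  have hcnt : ∀ a, (∑ A ∈ F, if a ∈ A then ((ws.getD (e a) 0 : ℕ) : ℤ) else 0) =
      (cnt a F : ℤ) * ((ws.getD (e a) 0 : ℕ) : ℤ) := by
    intro a
    rw [← Finset.sum_filter, Finset.sum_const, nsmul_eq_mul]
    rfl
  simp only [hcnt] at htot
  by_contra hno
  have hlt : ∀ a, 2 * cnt a F + 1 ≤ F.card := by
    intro a
    by_cases ha : a ∈ famUnion F
    · by_contra h
      exact hno ⟨a, ha, by omega⟩
    · have : cnt a F = 0 := by
        unfold cnt
        rw [Finset.card_eq_zero, Finset.filter_eq_empty_iff]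
        intro A hA haA
        apply ha
        unfold famUnion
        rw [Finset.mem_sup]
        exact ⟨A, hA, haA⟩
      omega
  have hS : ∑ a ∈ X0, ((ws.getD (e a) 0 : ℕ) : ℤ) ≤ (ws.sum : ℤ) := by
    rw [← sum_getD ws, hlen]
    push_cast
    rw [← Finset.sum_image (s := X0) (g := e) (f := fun i => ((ws.getD i 0 : ℕ) : ℤ)) hinj0]
    apply Finset.sum_le_sum_of_subset_of_nonneg
    · intro i hi
      obtain ⟨a, ha, rfl⟩ := Finset.mem_image.1 hi
      exact Finset.mem_range.2 (h70 a ha)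
    · intro i _ _
      positivity
  have hle : 2 * ∑ a ∈ X0, (cnt a F : ℤ) * ((ws.getD (e a) 0 : ℕ) : ℤ) ≤
      ((F.card : ℤ) - 1) * ∑ a ∈ X0, ((ws.getD (e a) 0 : ℕ) : ℤ) := by
    rw [Finset.mul_sum, Finset.mul_sum]
    apply Finset.sum_le_sum
    intro a _
    have h1 : 2 * (cnt a F : ℤ) ≤ (F.card : ℤ) - 1 := by
      have := hlt a
      omega
    have h2 : (0 : ℤ) ≤ ((ws.getD (e a) 0 : ℕ) : ℤ) := by positivity
    nlinarith
  have hF1 : (1 : ℤ) ≤ (F.card : ℤ) := by omega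
  have hW1 : (1 : ℤ) ≤ (ws.sum : ℤ) := by omega
  nlinarith

theorem pim_inj {p : ℕ} (hp : act p 127 = 127) : Set.InjOn (pim p) (Finset.range 7) := by
  have himg : Finset.range 7 ⊆ (Finset.range 7).image (pim p) := by
    intro j hj
    have h1 : (act p 127).testBit j = true := by
      rw [hp]
      have : ∀ j ∈ Finset.range 7, Nat.testBit 127 j = true := by decide
      exact this j hj
    obtain ⟨i, hi, _, rfl⟩ := (testBit_act p 127 j).1 h1
    exact Finset.mem_image_of_mem _ (Finset.mem_range.2 hi)
  apply Finset.card_image_iff.1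
  exact le_antisymm Finset.card_image_le (Finset.card_le_card himg)

theorem pim_lt {p : ℕ} (hp : act p 127 = 127) (i : ℕ) (hi : i < 7) : pim p i < 7 := by
  have h0 : ∀ j ∈ Finset.range 7, Nat.testBit 127 j = true := by decide
  have h1 : (act p 127).testBit (pim p i) = true :=
    (testBit_act p 127 _).2 ⟨i, hi, h0 i (Finset.mem_range.2 hi), rfl⟩
  rw [hp] at h1
  by_contra h
  have h2 : Nat.testBit 127 (pim p i) = false :=
    Nat.testBit_lt_two_pow (lt_of_lt_of_le (by norm_num : 127 < 2 ^ 7)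
      (Nat.pow_le_pow_right (by norm_num) (by omega)))
  rw [h2] at h1
  exact absurd h1 (by simp)

theorem memb_iff (m : ℕ) (L : List ℕ) : memb m L = true ↔ m ∈ L := by
  unfold memb
  rw [List.any_eq_true]
  constructor
  · rintro ⟨x, hx, h⟩
    exact Nat.eq_of_beq_eq_true h ▸ hx
  · intro h
    exact ⟨m, h, by simp⟩

theorem mem_T3 {α : Type*} [DecidableEq α] {e : α → ℕ} {X A : Finset α} {m : ℕ}
    (hinj : Set.InjOn e X) (h7 : ∀ a ∈ X, e a < 7) (hA : A ⊆ X) (hc : A.card = 3)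
    (hm : Rep e A m) : m ∈ T3 := by
  obtain ⟨a, b, c, hab, hac, hbc, rfl⟩ := Finset.card_eq_three.1 hc
  have ha : a ∈ X := hA (by simp)
  have hb : b ∈ X := hA (by simp)
  have hc : c ∈ X := hA (by simp)
  have h1 : m = 2 ^ (e a) ||| (2 ^ (e b) ||| 2 ^ (e c)) := by
    apply hm.uniq
    intro i
    simp [Nat.testBit_or, Nat.testBit_two_pow]
  have h2 : ∀ i ∈ Finset.range 7, ∀ j ∈ Finset.range 7, ∀ k ∈ Finset.range 7, i ≠ j → i ≠ k →
      j ≠ k → 2 ^ i ||| (2 ^ j ||| 2 ^ k) ∈ T3 := by decide +kernel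
  rw [h1]
  refine h2 _ (Finset.mem_range.2 (h7 a ha)) _ (Finset.mem_range.2 (h7 b hb)) _
    (Finset.mem_range.2 (h7 c hc)) ?_ ?_ ?_
  · exact fun h => hab (hinj ha hb h)
  · exact fun h => hac (hinj ha hc h)
  · exact fun h => hbc (hinj hb hc h)

/-- The masks in `L` are realised by members of `S` through some labelling of `X`. -/
def Rlz {α : Type*} (X : Finset α) (S : Finset (Finset α)) (L : List ℕ) : Prop :=
  ∃ e : α → ℕ, Set.InjOn e X ∧ (∀ a ∈ X, e a < 7) ∧ ∀ m ∈ L, ∃ A ∈ S, A ⊆ X ∧ Rep e A m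

theorem Rlz.mono {α : Type*} {X : Finset α} {S S' : Finset (Finset α)} {L : List ℕ}
    (h : S ⊆ S') : Rlz X S L → Rlz X S' L := by
  rintro ⟨e, h1, h2, h3⟩
  refine ⟨e, h1, h2, fun m hm => ?_⟩
  obtain ⟨A, hA, h4⟩ := h3 m hm
  exact ⟨A, h hA, h4⟩

theorem step {α : Type*} [DecidableEq α] {L : List ℕ} {targets : List (List ℕ)} {tab : List ℕ}
    (hchk : chkStep L targets tab = true) {X : Finset α} {S : Finset (Finset α)} {B : Finset α}
    (hS : Rlz X S L) (hB : B ⊆ X) (hc : B.card = 3) (hBS : B ∉ S) :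
    ∃ t ∈ targets, Rlz X (insert B S) t := by
  obtain ⟨e, hinj, h7, hr⟩ := hS
  obtain ⟨m, hm⟩ := exists_rep e B
  have hmT := mem_T3 hinj h7 hB hc hm
  have hmL : m ∉ L := by
    intro h
    obtain ⟨A, hA, hAX, hAm⟩ := hr m h
    exact hBS (Rep.inj hinj hB hAX hm hAm ▸ hA)
  simp only [chkStep, Bool.and_eq_true] at hchk
  obtain ⟨hl, hchk⟩ := hchk
  have hl : tab.length = 35 := Nat.eq_of_beq_eq_true hl
  rw [List.all_eq_true] at hchk
  obtain ⟨k, hk, hkm⟩ := List.mem_iff_getElem.1 hmT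
  have hk35 : k < 35 := hk
  have hz : (m, tab[k]'(by omega)) ∈ T3.zip tab := by
    rw [List.mem_iff_getElem]
    exact ⟨k, by rw [List.length_zip, hl]; exact lt_min hk hk35, by simp [hkm]⟩
  generalize tab[k]'(by omega) = p at hz
  have h := hchk _ hz
  simp only [Bool.or_eq_true, Bool.and_eq_true, memb_iff, List.any_eq_true, List.all_eq_true] at h
  rcases h with h | ⟨hp, t, ht, h⟩
  · exact absurd h hmL
  have hp : act p 127 = 127 := Nat.eq_of_beq_eq_true hp
  refine ⟨t, ht, fun a => pim p (e a), ?_, fun a ha => pim_lt hp _ (h7 a ha), ?_⟩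
  · intro a ha b hb hab
    exact hinj ha hb (pim_inj hp (by simpa using h7 a ha) (by simpa using h7 b hb) hab)
  · intro q hq
    obtain ⟨m', hm', rfl⟩ := List.mem_map.1 (h q hq)
    have hA : ∃ A ∈ insert B S, A ⊆ X ∧ Rep e A m' := by
      rcases List.mem_cons.1 hm' with rfl | hm'
      · exact ⟨B, Finset.mem_insert_self _ _, hB, hm⟩
      · obtain ⟨A, hA, h4⟩ := hr m' hm'
        exact ⟨A, Finset.mem_insert_of_mem hA, h4⟩
    obtain ⟨A, hA, hAX, hAm⟩ := hA
    refine ⟨A, hA, hAX, fun j => ?_⟩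
    rw [testBit_act]
    constructor
    · rintro ⟨i, _, h1, h2⟩
      obtain ⟨a, ha, rfl⟩ := (hAm i).1 h1
      exact ⟨a, ha, h2⟩
    · rintro ⟨a, ha, h2⟩
      exact ⟨e a, h7 a (hAX ha), (hAm _).2 ⟨a, ha, rfl⟩, h2⟩

def lev1 : List (List ℕ) := [[7]]

def lev2 : List (List ℕ) := [[7, 11], [7, 25], [7, 56]]

def lev3 : List (List ℕ) :=
  [[7, 11, 13], [7, 11, 19], [7, 11, 21], [7, 11, 28], [7, 11, 49], [7, 11, 52], [7, 11, 112], [7,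
  25, 42], [7, 25, 97], [7, 25, 98]]

def cfgs : List (List ℕ) :=
  [[7, 11, 13], [7, 11, 19], [7, 11, 21], [7, 11, 28], [7, 11, 49, 81], [7, 11, 49, 82], [7, 11,
  49, 84], [7, 11, 49, 112], [7, 11, 52, 56], [7, 11, 52, 88], [7, 11, 52, 112], [7, 25, 42, 52],
  [7, 25, 42, 76], [7, 25, 42, 84]]

def tab0 : List ℕ :=
  [1754760, 1754312, 1754200, 1754179, 1747144, 1747032, 1747011, 1745688, 1745667, 1745443,
  1661128, 1661016, 1660995, 1659672, 1659651, 1659427, 1645336, 1645315, 1645091, 1642851,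
  743624, 743512, 743491, 742168, 742147, 741923, 727832, 727811, 727587, 725347, 584472, 584451,
  584227, 581987, 560483]

theorem tab0_ok : chkStep [] lev1 tab0 = true := by decide +kernel

def tab1 : List ℕ :=
  [0, 1754760, 1754704, 1754690, 1751176, 1751120, 1751106, 1754760, 1754753, 1754641, 1693832,
  1693776, 1693762, 1726088, 1726081, 1725969, 1718920, 1718913, 1718801, 1754760, 1005704,
  1005648, 1005634, 1267336, 1267329, 1267217, 1260168, 1260161, 1260049, 1525384, 1174152,
  1174145, 1174033, 1468040, 1457288]

theorem tab1_ok : chkStep [7] lev2 tab1 = true := by decide +kernel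

def tab2 : List ℕ :=
  [0, 0, 1754760, 1754753, 1754760, 1754760, 1754753, 1754312, 1754305, 1754760, 1726088, 1726088,
  1726081, 1725640, 1725633, 1726088, 1754760, 1754753, 1754760, 1754312, 1267336, 1267336,
  1267329, 1266888, 1266881, 1267336, 1525384, 1525377, 1525384, 1524936, 1468040, 1468033,
  1468040, 1467592, 1754760]

theorem tab2_ok : chkStep [7, 11] lev3 tab2 = true := by decide +kernel

def tab3 : List ℕ :=
  [0, 1754312, 1754200, 1754690, 1747144, 1747032, 1751106, 0, 1741082, 1741026, 1693832, 1693776,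
  1693762, 1680224, 1754760, 1754704, 1676640, 1751176, 1751120, 1675618, 1005704, 1005648,
  1005634, 992096, 1525384, 1525328, 988512, 1521800, 1521744, 987490, 1754760, 1754760, 1754704,
  1745688, 1742104]

theorem tab3_ok : chkStep [7, 25] lev3 tab3 = true := by decide +kernel

def tab4 : List ℕ :=
  [0, 1754312, 1754200, 1754179, 1747144, 1747032, 1747011, 1675618, 1675604, 1675436, 1661128,
  1661016, 1660995, 1618274, 1618260, 1618092, 1607522, 1607508, 1607340, 0, 1005704, 1005648,
  1005634, 742168, 742147, 741923, 727832, 727811, 727587, 856492, 584472, 584451, 584227, 827820,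
  820652]

theorem tab4_ok : chkStep [7, 56] lev3 tab4 = true := by decide +kernel

def tab5 : List ℕ :=
  [0, 0, 1754760, 1754753, 1754760, 1754760, 1754753, 1754312, 1754305, 1754760, 1726088, 1726088,
  1726081, 1725640, 1725633, 1726088, 0, 1608474, 1608418, 1607522, 1267336, 1267336, 1267329,
  1266888, 1266881, 1267336, 1754760, 1754760, 1754760, 1754312, 1726088, 1726088, 1726088,
  1725640, 1754760]

theorem tab5_ok : chkStep [7, 11, 49] cfgs tab5 = true := by decide +kernel

def tab6 : List ℕ :=
  [0, 0, 1754760, 1754753, 1754760, 1754760, 1754753, 1754312, 1754305, 1754760, 1726088, 1726088,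
  1726081, 1725640, 1725633, 1726088, 1608418, 1608404, 0, 1754760, 1267336, 1267336, 1267329,
  1266888, 1266881, 1267336, 1525384, 1525377, 859180, 1754760, 1468040, 1468033, 830508, 1726088,
  1754760]

theorem tab6_ok : chkStep [7, 11, 52] cfgs tab6 = true := by decide +kernel

def tab7 : List ℕ :=
  [0, 0, 1754760, 1754753, 1754760, 1754760, 1754753, 1754312, 1754305, 1754760, 1726088, 1726088,
  1726081, 1725640, 1725633, 1726088, 1754760, 1754753, 1754760, 1754312, 1267336, 1267336,
  1267329, 1266888, 1266881, 1267336, 1525384, 1525377, 1525384, 1524936, 1468040, 1468033,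
  1468040, 1467592, 0]

theorem tab7_ok : chkStep [7, 11, 112] cfgs tab7 = true := by decide +kernel

def tab8 : List ℕ :=
  [0, 1754312, 1726032, 1754690, 1747144, 1747032, 1751106, 0, 1741082, 1741026, 1661121, 1693776,
  1660995, 1651041, 0, 1626324, 1676640, 1619268, 1754760, 1642851, 1005704, 1005648, 976962,
  992096, 877380, 1754760, 988512, 1745688, 1754760, 954786, 1659651, 845124, 1726081, 840084,
  1712473]

theorem tab8_ok : chkStep [7, 25, 42] cfgs tab8 = true := by decide +kernel

def tab9 : List ℕ :=
  [0, 1754312, 1754200, 1754690, 1747144, 1747032, 1751106, 0, 1741082, 1741026, 1141448, 1141336,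
  1174082, 1127336, 1659651, 1659427, 1120168, 1645315, 1645091, 1151402, 682696, 682584, 944706,
  668584, 742147, 741923, 661416, 727811, 727587, 922026, 0, 289562, 289506, 280490, 276906]

theorem tab9_ok : chkStep [7, 25, 97] cfgs tab9 = true := by decide +kernel

def tab10 : List ℕ :=
  [0, 1754312, 1754200, 1754690, 1747144, 1747032, 1751106, 0, 1741082, 1741026, 1141441, 1174096,
  1141315, 1651552, 845124, 1725969, 1644384, 830788, 1718801, 1675618, 682689, 944720, 682563,
  734048, 386372, 1267217, 726880, 372036, 1260049, 987490, 289562, 0, 289492, 288596, 277844]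

theorem tab10_ok : chkStep [7, 25, 98] cfgs tab10 = true := by decide +kernel
def cert0 : Ct :=
  .N 2 (.N 8 (.L [4162, 4354, 16708]) (.L [422, 4162])) (.N 1 (.L [32802]) (.L [354, 490, 16614,
  16802, 24930, 33124, 33186, 49570]))

theorem cert0_ok : chkCfg [7, 11, 13] [4, 3, 2, 3, 0, 0, 0] cert0 = true := by decide +kernel

def cert1 : Ct :=
  .N 4 (.N 24 (.L [356, 612, 4866, 4996, 8962, 9092, 21250, 25346, 36994, 41090, 69762, 73858])
  (.N 8 (.N 20 (.L [65800, 612, 4998, 9094]) (.L [65672, 612, 20738, 24834, 69762, 73858])) (.N 12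
  (.N 16 (.L [356, 4998, 9094]) (.L [356, 872, 4482, 4708, 24962])) (.L [356, 612, 36994, 41090,
  65896, 69762, 73858])))) (.N 8 (.N 9 (.N 16 (.L [228, 20994, 24834, 41474, 49442, 49954, 82212])
  (.L [228, 744, 4708, 20738, 24834, 82212])) (.L [4358, 228, 612, 20738, 24834, 65768, 69890,
  73986])) (.N 16 (.L [228, 488, 4452, 20994, 25090, 37378, 41474]) (.L [1004, 4324, 4578, 8930,
  9060, 20834, 25186, 37218, 41314, 49380, 70242, 74338, 82148, 98660])))

theorem cert1_ok : chkCfg [7, 11, 19] [3, 3, 2, 2, 2, 0, 0] cert1 = true := by decide +kernel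

def cert2 : Ct :=
  .N 1 (.N 10 (.N 16 (.L [16706, 17222, 25090, 33314, 33448, 49188, 73764]) (.L [33448, 49188,
  73764, 82244, 98662])) (.N 2 (.L [32842, 49188, 65896, 73764, 98982]) (.L [33448, 49188, 65896,
  73764]))) (.N 2 (.N 4 (.L [32962, 33448, 36994, 65730, 65896, 69698, 98502]) (.L [674, 33448,
  49218, 65896, 69698, 82594, 81986])) (.N 4 (.L [354, 33448, 36994, 41314, 41090, 65896, 73858])
  (.L [226, 1004, 24802, 33002, 37538, 41316, 49828, 65770, 69986, 74082, 74210, 82596, 98660,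
  98978])))

theorem cert2_ok : chkCfg [7, 11, 21] [4, 3, 3, 2, 2, 0, 0] cert2 = true := by decide +kernel

def cert3 : Ct :=
  .N 16 (.N 12 (.L [227, 355, 4483, 4994, 8579, 9090, 12801, 20993, 25089, 37377, 41473, 70019,
  74115]) (.N 4 (.L [32901, 355, 4997, 9093, 12801, 20993, 25089, 37377, 41473]) (.L [227, 486,
  4997, 9093, 12801, 20993, 25089, 33123, 32993, 37377, 41473]))) (.N 4 (.L [355, 4997, 9093,
  36993, 41089, 69761, 69858, 73857, 74082, 82147, 98659]) (.L [353, 1000, 4997, 9093, 12513,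
  20705, 24801, 32997, 37217, 41313, 49377, 69859, 74083, 82146, 82817, 98658, 98529]))

theorem cert3_ok : chkCfg [7, 11, 28] [2, 2, 2, 2, 1, 0, 0] cert3 = true := by decide +kernel

def cert4 : Ct :=
  .N 2 (.N 36 (.N 1 (.N 12 (.L [18978, 35362, 40484, 65762, 66024, 69858, 73764, 81954, 82020,
  98406, 98754, 106722, 114724, 131170, 135524, 169506, 205954, 213444, 262242, 262498, 263400,
  267652, 270566, 278888, 288130, 296170, 299394, 303138, 328132, 328900, 344098, 344130, 361670,
  393316, 393574, 398466, 491586]) (.L [18978, 36516, 40484, 66026, 69858, 73764, 82022, 98404,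
  102052, 106530, 114724, 131170, 135524, 169090, 181798, 205954, 229410, 230596, 262500, 263400,
  266306, 270566, 278888, 296170, 301602, 313894, 328900, 344098, 344130, 361670, 376898, 393316,
  393574, 398466, 435330, 442404, 491586])) (.N 72 (.N 9 (.L [3618, 18980, 19238, 22786, 66026,
  69698, 73956, 82148, 82210, 98662, 99522, 107650, 114978, 114754, 131426, 135234, 135522,
  141606, 198978, 205954, 232902, 266306, 267394, 270566, 279784, 328900, 344130, 346434, 376898,
  397378]) (.L [3618, 18980, 19236, 22786, 66026, 69698, 73956, 82148, 84770, 98662, 99874,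
  107650, 114754, 115906, 131428, 135234, 138626, 141670, 169090, 181798, 198978, 205954, 232902,
  266306, 267394, 270566, 279784, 300162, 328900, 344130, 346434, 376898, 397378])) (.L [3618,
  18978, 35362, 40484, 52776, 66026, 69698, 73954, 82150, 98662, 99874, 107650, 114754, 115906,
  131426, 135234, 135522, 169090, 181798, 205954, 262500, 263400, 266306, 267394, 270566, 278888,
  300162, 313894, 328900, 346658, 344130, 361670, 376898, 393706, 397378, 426342, 427202,
  491586]))) (.N 4 (.L [131212, 40484, 52776, 66026, 69762, 73954, 82150, 98662, 98498, 135234,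
  135522, 139494, 164072, 165410, 168066, 172386, 181798, 204930, 229572, 262498, 266306, 266594,
  270566, 278888, 299138, 313894, 336002, 363042, 360644, 393706, 397442, 401634, 409830, 426342,
  426178, 460322, 458948, 491716]) (.N 68 (.L [22050, 35362, 40484, 52776, 66026, 69698, 73954,
  82150, 98662, 99874, 108674, 114754, 116930, 131428, 131560, 135234, 137346, 139494, 166122,
  170114, 181798, 198852, 214562, 213058, 231622, 245826, 266596, 301186, 313894, 338050, 393448,
  394786, 397378, 426342, 428226, 491586]) (.N 88 (.L [3618, 22050, 27396, 52776, 65764, 66022,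
  69698, 73956, 84514, 84772, 98662, 99874, 106722, 114754, 114914, 131428, 131560, 135234,
  139494, 158466, 181798, 207618, 214562, 213058, 245826, 262500, 262632, 266306, 270566, 313890,
  346658, 344130, 393444, 393702, 397378, 401636, 411174, 426342, 426210, 434402, 445252, 475202])
  (.L [3618, 22050, 40484, 52776, 65764, 66022, 69698, 73956, 84514, 85540, 98662, 99874, 106722,
  114754, 114914, 131428, 131560, 135234, 139494, 181798, 214562, 213058, 245826, 262500, 262632,
  266306, 270566, 301602, 313894, 346658, 344130, 376898, 393706, 397378, 401636, 409828, 411170,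
  426342, 442434, 475202, 491586]))))) (.N 4 (.N 84 (.N 44 (.N 60 (.N 5 (.N 48 (.N 18 (.L [4450,
  4676, 35362, 40484, 57922, 69762, 114852, 135524, 139430, 169474, 266596, 270502, 278888,
  288130, 296426, 299138, 303812, 313894, 393378, 393448, 426342, 426562, 442532]) (.L [354, 2920,
  28292, 35362, 40484, 44678, 60034, 65762, 66024, 69762, 82150, 98662, 98530, 106626, 114852,
  131302, 135524, 140836, 141858, 157186, 169474, 173700, 206370, 262374, 266596, 272932, 271906,
  278888, 289410, 296426, 299138, 305794, 304642, 313894, 338466, 393378, 393448, 402980, 426342,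
  434306, 442532])) (.L [354, 1894, 26500, 35362, 40484, 44934, 66026, 69762, 73890, 77346, 82150,
  98662, 100194, 106626, 114852, 131302, 135524, 140838, 158338, 166762, 169506, 204930, 262374,
  266596, 272932, 271906, 278888, 289410, 296426, 299138, 305796, 313894, 328040, 338466, 393378,
  393448, 398882, 402978, 404098, 426342, 434306, 442532])) (.N 9 (.L [4230, 26500, 44934, 65762,
  66024, 69762, 75300, 82150, 98662, 98530, 106626, 114980, 131302, 135524, 141862, 158338,
  206370, 262372, 266596, 270562, 272932, 278888, 289410, 296426, 299138, 305796, 338466, 393448,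
  394786, 397442, 402978, 404098, 426342, 434306, 442660]) (.L [4230, 354, 1892, 26500, 34338,
  35362, 44934, 65762, 66024, 69762, 77348, 82150, 98660, 100196, 106850, 114914, 131302, 135524,
  140838, 158338, 166762, 168066, 204930, 262374, 262500, 267652, 272932, 271906, 278888, 289410,
  296426, 299138, 305796, 313894, 328040, 338466, 393448, 394786, 397442, 402978, 404098, 426342,
  434306, 493092]))) (.L [66954, 83334, 99720, 116100, 198024, 214404, 229510, 354, 1896, 21890,
  35362, 40484, 44934, 69762, 75140, 106626, 131302, 135524, 140838, 158338, 166762, 169506,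
  204930, 266596, 270566, 278888, 289410, 296426, 299138, 305796, 313894, 328040, 338466, 393448,
  394786, 397442, 402978, 404098, 426342, 434306])) (.N 10 (.L [163978, 3618, 34338, 35362, 40484,
  52776, 65762, 66024, 69762, 75300, 82150, 98662, 98754, 106722, 131302, 134086, 135492, 141862,
  147816, 158338, 168066, 206370, 213316, 231078, 262372, 266564, 270562, 272932, 278888, 289410,
  299138, 313894, 338466, 393706, 397442, 401634, 404098, 409830, 426342, 426434, 459074]) (.L
  [163978, 354, 1894, 3618, 34338, 35362, 40484, 52776, 65762, 66024, 69762, 77348, 82150, 98662,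
  100194, 106626, 114914, 131302, 135524, 140838, 147816, 158338, 168066, 174724, 204930, 231078,
  262374, 266596, 272932, 271906, 278888, 289410, 296810, 299138, 305796, 313894, 328040, 338466,
  393706, 397442, 401634, 404098, 409830, 426342, 434306]))) (.N 52 (.N 68 (.L [67722, 84102,
  327816, 354, 1890, 2920, 3618, 5990, 28292, 34338, 35362, 40484, 44678, 52776, 69762, 73956,
  98662, 98530, 106626, 114916, 131298, 131428, 133350, 135396, 140836, 141858, 147816, 157314,
  166122, 168066, 173700, 181798, 206370, 266596, 272934, 296810, 299138, 313894, 336002, 393442,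
  393574, 397442, 402980, 434306]) (.L [262284, 327816, 354, 2920, 3618, 34338, 40484, 52776,
  65762, 66024, 69762, 74084, 82150, 100200, 106850, 114914, 131302, 135524, 140836, 141858,
  147816, 157314, 166762, 168066, 173700, 181798, 206370, 266596, 270564, 272930, 286946, 295144,
  297506, 299138, 304772, 313894, 336002, 393442, 393704, 397442, 403076, 409830, 426342, 426210,
  434306])) (.N 14 (.L [196744, 327816, 354, 2920, 3618, 40484, 52776, 65762, 66024, 69762, 74084,
  82150, 100200, 106850, 115138, 114914, 131302, 135524, 140838, 147816, 166762, 168066, 181798,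
  204930, 230946, 229828, 262374, 266596, 272934, 278888, 299138, 313894, 336002, 363042, 360900,
  393706, 397442, 402980, 409830, 426342, 426434, 459206]) (.L [41094, 196744, 327816, 354, 1890,
  2920, 3618, 5988, 34338, 35362, 40484, 52776, 65762, 66024, 69762, 77348, 82150, 98662, 100194,
  106626, 114914, 131302, 135524, 140838, 147816, 166762, 168066, 181798, 204930, 262374, 266596,
  272934, 278888, 299138, 313894, 336002, 393442, 393704, 397442, 402980, 409830, 426342, 426210,
  434306])))) (.N 20 (.N 100 (.L [354, 1892, 4582, 21122, 24804, 34338, 35362, 37508, 44678,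
  52776, 57986, 69482, 73250, 76932, 98660, 100196, 106850, 131302, 135524, 140836, 141858,
  147816, 156290, 171138, 172676, 181798, 206370, 262374, 266596, 272932, 271906, 278888, 287362,
  302210, 303748, 313894, 328040, 338466, 393574, 400514, 402980, 437378, 493092]) (.N 10 (.L
  [21122, 24804, 36386, 37508, 52776, 65894, 73250, 75300, 131302, 135492, 141862, 147816, 156290,
  169506, 172676, 181798, 206370, 262374, 266564, 272932, 271906, 278888, 287362, 301602, 303748,
  313894, 338466, 393444, 393702, 397538, 402052, 426342, 426210, 434402, 442690, 459718, 493090,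
  491842]) (.L [354, 1890, 3618, 4582, 21122, 24804, 37508, 52776, 57986, 69482, 69986, 75298,
  77346, 98658, 100198, 106850, 131302, 135524, 140834, 141860, 147816, 156290, 169506, 172676,
  181798, 206370, 262374, 266596, 272932, 271906, 278888, 287362, 301602, 303748, 313894, 328040,
  338466, 393446, 393700, 397538, 402052, 426342, 426210, 434818, 442596, 493092]))) (.N 18 (.N
  100 (.L [354, 484, 4578, 4676, 23682, 24804, 40068, 44742, 52776, 57922, 73250, 135524, 139494,
  147816, 156226, 169506, 181798, 214564, 246338, 266596, 270566, 278888, 287298, 301602, 313894,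
  346660, 377410, 393574, 426562, 437378, 493092]) (.L [354, 484, 4578, 4676, 24098, 24804, 40484,
  52776, 57922, 73250, 116258, 117282, 131556, 135524, 139494, 147812, 150052, 156226, 169506,
  181796, 180802, 214564, 246338, 266596, 270566, 278888, 287298, 301602, 313892, 311874, 346660,
  377410, 393442, 393704, 397538, 401636, 426342, 426562, 434402, 442948, 475714])) (.N 6 (.N 88
  (.L [354, 1896, 3618, 24098, 52776, 65766, 66020, 69826, 98662, 98530, 106690, 114916, 131302,
  134082, 135524, 140838, 147816, 169506, 181798, 196802, 207394, 214564, 229570, 232388, 245954,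
  262374, 266596, 272934, 278888, 313894, 327874, 337442, 346660, 393444, 393702, 397506, 402980,
  409826, 411172, 426342, 426178, 436994, 442596, 458948]) (.L [354, 1896, 2914, 3618, 24098,
  40484, 52776, 65766, 66020, 69826, 98662, 98530, 106690, 114916, 131302, 135524, 140838, 147816,
  166762, 169506, 181798, 196802, 207394, 214564, 229572, 262374, 266596, 272934, 278888, 301602,
  313894, 327874, 328038, 337442, 346660, 377026, 393444, 393702, 397506, 402980, 409826, 411172,
  426342, 426178, 434402, 442594, 458948, 491716])) (.N 10 (.N 36 (.L [228, 2794, 7714, 23074,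
  34338, 35362, 40484, 52776, 65766, 66020, 69858, 98662, 98530, 106722, 115010, 114914, 135492,
  140838, 169090, 181798, 198084, 205954, 262500, 263400, 266468, 270562, 272932, 278888, 288194,
  296170, 300162, 313894, 338466, 346658, 344386, 361926, 377154, 393574, 398466, 402980, 459074])
  (.L [228, 1770, 6882, 7714, 7906, 22050, 34338, 40484, 52776, 65766, 66020, 69858, 98662, 98530,
  106722, 115010, 114914, 131298, 133866, 135394, 135490, 140836, 141858, 155874, 164194, 164072,
  181798, 206370, 214562, 213314, 246082, 262372, 264936, 266564, 272932, 271906, 278886, 281122,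
  286946, 295138, 301602, 313894, 338466, 346658, 344386, 377154, 393446, 393700, 397538, 402980,
  411174, 426342, 426210, 434402, 442690, 442594, 459074, 475458])) (.N 12 (.N 80 (.L [228, 1770,
  4450, 5988, 24098, 34338, 34660, 35362, 40484, 65766, 66020, 69858, 98662, 98530, 106882,
  114916, 131302, 135524, 140836, 141858, 147816, 158594, 168322, 174980, 206370, 214564, 262374,
  266596, 272932, 271906, 278888, 289282, 299394, 306052, 338466, 346660, 393442, 393704, 397698,
  401636, 409826, 411172, 426342, 426210, 434562]) (.L [228, 1770, 4450, 5988, 24098, 35688,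
  36388, 38434, 39458, 65766, 66020, 69858, 98662, 98530, 106882, 114916, 133868, 135394, 135522,
  140836, 141858, 147682, 147814, 155874, 166762, 168322, 172386, 173602, 180450, 196962, 199202,
  206370, 214564, 262370, 264938, 266466, 266594, 272932, 271906, 278888, 286946, 295266, 299394,
  338466, 346660, 393446, 393700, 397698, 402980, 409826, 411172, 426342, 426210, 434562,
  442596])) (.N 36 (.L [226, 354, 2794, 4582, 20706, 35564, 40484, 65766, 66020, 69858, 98662,
  98530, 107650, 114916, 132968, 133666, 135524, 140838, 166762, 169090, 181798, 205954, 230946,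
  262500, 263400, 266468, 272932, 271906, 278888, 286946, 296170, 300162, 313894, 328040, 338466,
  346660, 363042, 393574, 398466, 402980, 427688, 435330]) (.N 14 (.L [228, 1770, 4450, 5988,
  24098, 34338, 34660, 40484, 65762, 66024, 69858, 98662, 98530, 106946, 118308, 133868, 135524,
  139494, 156002, 166762, 168162, 172260, 181798, 197060, 199202, 206370, 214564, 262370, 264938,
  266596, 270562, 272932, 278888, 286946, 301602, 313894, 328040, 338466, 346660, 360900, 393706,
  397538, 401636, 409826, 411172, 426342, 426434, 443940, 459206]) (.L [228, 4074, 4582, 22242,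
  33122, 34538, 38756, 65766, 66020, 69858, 98660, 98532, 106850, 114914, 118306, 131302, 133862,
  135524, 140836, 141858, 156002, 166762, 168162, 172260, 181798, 196840, 206370, 214564, 230946,
  229732, 245986, 262372, 265192, 269028, 272932, 271906, 278754, 278882, 281316, 289314, 295268,
  295140, 296674, 301602, 303330, 304866, 313894, 328038, 329442, 338466, 346660, 360802, 360676,
  378402, 393444, 393702, 397538, 402980, 409826, 411172, 426342, 426210, 434402, 443940, 460322,
  458980, 476706, 493092])))))))))

theorem cert4_ok : chkCfg [7, 11, 49, 81] [4, 3, 2, 1, 2, 1, 1] cert4 = true := by decide +kernel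

def cert5 : Ct :=
  .N 68 (.N 1 (.N 2 (.N 58 (.L [17956, 26438, 35526, 36522, 50724, 65894, 69700, 82024, 98538,
  103970, 109122, 114722, 114754, 116258, 131170, 135398, 149738, 153730, 157826, 166124, 168004,
  174212, 180328, 198856, 213060, 247938, 262242, 296486, 299076, 344100, 360482, 362660, 376866,
  393318, 394788, 426088, 442404, 458820]) (.L [229446, 17956, 35526, 36522, 50724, 65894, 69700,
  82024, 98538, 103970, 109122, 114722, 114754, 116258, 131170, 131560, 133604, 135398, 141796,
  149738, 153730, 157826, 166116, 166470, 166594, 168004, 174212, 182856, 198856, 213060, 245826,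
  262242, 296486, 299076, 344100, 360482, 362660, 376866, 393318, 394788, 426088, 442404, 458820,
  493698])) (.N 10 (.L [13858, 17956, 36522, 50724, 65894, 71812, 73764, 82152, 98538, 103970,
  114722, 115010, 116258, 133700, 133958, 135398, 139298, 140836, 149738, 153730, 157826, 166124,
  168260, 174212, 180456, 199368, 213316, 229698, 231554, 246082, 270370, 296486, 299332, 360482,
  362660, 376866, 396234, 401442, 426344, 442404, 458788]) (.N 6 (.L [13858, 17956, 35526, 36522,
  50722, 65894, 71812, 73764, 82152, 98538, 103970, 106690, 114722, 116260, 131560, 133700,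
  135366, 140838, 149738, 153730, 157826, 166124, 168292, 174212, 182856, 198856, 213188, 229574,
  247938, 270370, 297538, 296486, 299364, 362662, 401442, 426344, 442404, 458788, 494146]) (.L
  [13858, 35526, 36522, 50722, 65894, 71812, 73764, 82152, 98538, 103970, 109122, 114722, 116260,
  131560, 133700, 135398, 140838, 149738, 153730, 157826, 166124, 168292, 174212, 182856, 199368,
  213028, 232006, 247938, 270370, 296486, 299364, 362662, 401442, 426344, 442404, 458788,
  494274])))) (.N 16 (.N 18 (.L [226, 482, 14914, 17956, 23172, 38434, 39558, 49730, 53474, 53762,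
  70212, 102058, 109122, 116262, 131428, 131558, 133700, 135398, 139746, 141796, 149738, 153730,
  157826, 164418, 166120, 166594, 170116, 174212, 180806, 182850, 199368, 213572, 232006, 247938,
  262498, 266822, 296486, 299362, 299522, 363206, 426344, 442948, 460324, 494274]) (.L [8714, 226,
  482, 12802, 23170, 38434, 39558, 53474, 53762, 57858, 72258, 71810, 102058, 109122, 116262,
  131428, 131556, 133700, 135398, 140838, 149738, 153730, 156162, 166124, 170116, 174212, 180452,
  182852, 199368, 214564, 232006, 247938, 262498, 268870, 296486, 299362, 299522, 363206, 403586,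
  426344, 444996, 460324, 494274])) (.N 2 (.L [14914, 17956, 35526, 36522, 38434, 43586, 50722,
  69700, 74084, 82152, 98538, 104578, 106850, 114754, 116260, 131298, 131428, 131556, 133700,
  135234, 135396, 139746, 141794, 149738, 153730, 157826, 166122, 166466, 170116, 174212, 180450,
  182854, 198856, 213060, 229442, 232004, 245826, 268870, 299076, 362022, 397378, 426344, 444996,
  460324, 493698]) (.N 44 (.L [226, 1772, 13858, 23940, 34666, 35526, 38434, 43586, 53476, 60804,
  71812, 75140, 82152, 98662, 98532, 104578, 107906, 114918, 133998, 135398, 140838, 149738,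
  153730, 157826, 168292, 199368, 214564, 232006, 247938, 265836, 268870, 297834, 299364, 362022,
  395844, 426344, 460324]) (.L [226, 1772, 3940, 13858, 18286, 34666, 35526, 38434, 40550, 52906,
  53476, 71812, 74084, 82152, 98538, 102754, 109122, 116262, 131428, 131558, 133988, 135398,
  140838, 149738, 151906, 157826, 166124, 170116, 174212, 199368, 214564, 232006, 247938, 265836,
  268870, 297834, 299364, 362022, 393572, 395844, 399490, 426340, 428740, 444996, 460324,
  494274]))))) (.N 64 (.N 1 (.L [18446, 9768, 10274, 24102, 27204, 50722, 52778, 54820, 65894,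
  73764, 82152, 98538, 103970, 108546, 114722, 116772, 131560, 135398, 141350, 149738, 153602,
  157698, 166124, 168292, 174660, 182856, 213028, 231462, 247810, 284194, 313926, 344100, 360482,
  376866, 412230, 426344, 442404, 461380, 494146]) (.N 12 (.L [18446, 226, 1764, 10090, 14338,
  24102, 34338, 35394, 36388, 65892, 67304, 70018, 72258, 74082, 75298, 82152, 98538, 104450,
  106882, 131298, 133346, 135396, 137602, 140838, 149736, 150082, 153602, 157698, 166124, 168292,
  174468, 180456, 214564, 232994, 232004, 247810, 268870, 284194, 346692, 396234, 397698, 412230,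
  426344, 461380, 494146]) (.L [18446, 226, 482, 1762, 2022, 10090, 14338, 24102, 34338, 53474,
  56866, 59972, 65890, 67306, 69986, 72258, 74082, 75298, 82152, 98538, 104450, 108546, 116262,
  131558, 133096, 135398, 140838, 149736, 150082, 153602, 157698, 166124, 168292, 174660, 180450,
  182854, 214564, 232998, 247810, 268870, 284194, 312872, 346692, 379458, 393442, 412230, 426344,
  444996, 461380, 494146]))) (.N 20 (.N 36 (.L [226, 1896, 5986, 6728, 11114, 13858, 34338, 35526,
  37506, 41602, 42630, 53476, 69228, 69988, 74884, 102090, 102754, 109122, 116262, 133998, 140838,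
  168292, 199236, 232006, 266466, 266884, 270564, 270690, 283778, 287874, 295266, 296170, 299652,
  304260, 311528, 329384, 362020, 362146, 377986, 393450, 397666, 401762, 409954, 426340, 427684,
  443940, 460324, 493090]) (.L [226, 1890, 3938, 5992, 6722, 11114, 14914, 35394, 35524, 53476,
  69228, 72260, 75300, 98662, 103042, 107138, 116262, 133698, 133996, 135398, 140836, 139906,
  156290, 165410, 166602, 168292, 172676, 180456, 199368, 232006, 266468, 266882, 270562, 270692,
  283266, 296482, 296618, 299652, 311528, 329384, 363202, 362020, 393450, 397794, 404034, 409958,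
  426344, 442596, 460324, 492162])) (.N 16 (.L [16910, 482, 4322, 6728, 9768, 12802, 27204, 51782,
  53474, 53762, 57858, 103970, 109122, 116262, 131560, 133700, 135398, 150088, 156162, 168292,
  172546, 182856, 214564, 232006, 248386, 266470, 270690, 270820, 283138, 287074, 295138, 299362,
  299522, 312872, 345636, 362022, 378402, 393450, 397794, 409958, 426344, 442596, 460324]) (.N 32
  (.N 76 (.L [2796, 2918, 6726, 7012, 8418, 9768, 13314, 19010, 20040, 34338, 35394, 53476, 60804,
  69860, 73956, 98538, 102754, 107522, 116262, 170372, 214564, 232006, 248194, 266470, 283650,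
  287746, 299364, 346690, 345634, 362022, 393450, 411174, 426344, 460324]) (.L [2796, 2918, 6728,
  7010, 8418, 9768, 13314, 19310, 27202, 34338, 35394, 35682, 51778, 52810, 53476, 59972, 69860,
  73956, 98660, 98534, 102754, 107522, 114916, 116258, 150088, 181796, 214564, 232006, 266470,
  270822, 283650, 287746, 296172, 299364, 303330, 346690, 345634, 362022, 377858, 393450, 411174,
  426344, 443940, 460324])) (.L [4082, 5858, 6728, 9764, 11106, 11876, 12514, 17956, 18278, 19012,
  24166, 28262, 34338, 35566, 38760, 42530, 43586, 43874, 44642, 50722, 50916, 51782, 53476,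
  58916, 69860, 73956, 98658, 98536, 102754, 106850, 114914, 116260, 135398, 140836, 141890,
  149224, 150082, 153314, 158274, 164068, 166760, 168292, 172260, 182856, 200296, 215620, 232006,
  248386, 266470, 273122, 272100, 284194, 289506, 295144, 297828, 299364, 306018, 304674, 312872,
  327912, 345636, 362022, 378402, 393450, 397794, 404034, 409958, 426344, 442596, 460324,
  491874])))))

theorem cert5_ok : chkCfg [7, 11, 49, 82] [4, 4, 2, 1, 3, 2, 2] cert5 = true := by decide +kernel

def cert6 : Ct :=
  .N 36 (.N 1 (.N 2 (.N 24 (.L [17218, 21252, 54402, 65768, 66756, 69698, 81954, 131426, 262498,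
  263714, 264042, 267878, 270822, 271906, 278630, 278882, 287874, 296172, 299778, 299842, 303906,
  304260, 311330, 312484, 327780, 328036, 335906, 362022, 393450, 398946, 401444, 409636, 426086,
  426818, 434946, 442402, 458786, 458818, 491618]) (.L [35496, 36484, 38568, 44682, 54402, 65634,
  66026, 69858, 69986, 73958, 81954, 83140, 103970, 106530, 114724, 131426, 166572, 230598,
  262498, 264044, 267878, 270822, 271906, 278630, 278882, 287874, 296172, 300162, 300578, 305798,
  311330, 312484, 328040, 335906, 360482, 362020, 393450, 398946, 401444, 409636, 426086, 427202,
  435330, 458788, 491586])) (.N 24 (.L [13860, 21252, 26498, 27268, 44682, 54402, 58114, 59266,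
  65768, 73762, 75298, 74882, 81954, 107650, 109186, 131426, 141960, 205954, 262498, 264044,
  266470, 271912, 278888, 287874, 296172, 299778, 300162, 305796, 304258, 311330, 312484, 328040,
  335906, 362022, 393450, 401444, 409636, 426342, 435330, 458788]) (.L [13860, 27268, 35496,
  36484, 38568, 44682, 54402, 60034, 65762, 66026, 69988, 73762, 75298, 74882, 82150, 103970,
  107652, 114724, 131426, 141960, 166572, 205954, 262498, 264044, 266470, 271912, 278888, 287874,
  296172, 305796, 304258, 312486, 328040, 335906, 362022, 393450, 401444, 409636, 426342, 435330,
  458788]))) (.N 16 (.N 72 (.N 3 (.L [9860, 10884, 11650, 23172, 27398, 34338, 38536, 44682,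
  54402, 57858, 60802, 72580, 104706, 131426, 137574, 141960, 171396, 173702, 207106, 263716,
  263786, 268930, 267396, 270950, 271490, 278630, 301700, 393450, 400770, 401508, 434690]) (.L
  [226, 484, 9860, 10884, 11650, 20994, 22786, 27398, 34338, 34470, 38018, 38530, 39556, 44682,
  53762, 57858, 60802, 72324, 75302, 104706, 131426, 137574, 141960, 171396, 173702, 207106,
  262374, 268930, 267396, 271912, 287874, 301700, 337442, 393450, 400770, 401922, 404226,
  460324])) (.L [226, 482, 9860, 10884, 12770, 12802, 20994, 23170, 34338, 34470, 38530, 39558,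
  44682, 53762, 57858, 60034, 72324, 75302, 105090, 109188, 118404, 131426, 141960, 167596,
  169090, 173702, 262498, 263660, 266466, 267396, 271912, 278756, 278884, 287874, 299522, 300162,
  304260, 304674, 311524, 328040, 337442, 362022, 393450, 397666, 401764, 426856, 434690, 460324,
  491874])) (.N 2 (.L [23172, 34338, 34470, 36482, 38562, 39558, 44682, 54402, 69698, 72322,
  73958, 82146, 83140, 98538, 105090, 106852, 114754, 118402, 131426, 167596, 230598, 262498,
  264044, 267396, 267874, 270822, 271906, 278758, 278882, 287874, 296172, 300164, 305798, 312516,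
  328040, 337442, 362022, 393448, 394786, 397378, 402980, 409826, 426342, 460322, 458818, 491586])
  (.L [484, 1896, 3044, 13860, 19180, 23172, 24802, 27268, 34472, 39560, 44682, 54402, 60034,
  69988, 73954, 75298, 74882, 82150, 98538, 103970, 107652, 118404, 131426, 141960, 167596,
  205954, 262498, 265194, 264034, 268930, 267396, 271912, 278758, 278882, 287874, 296172, 300164,
  305796, 304258, 311526, 328040, 337442, 362022, 393450, 397666, 401764, 427880, 435330, 460324,
  491874])))) (.N 4 (.N 40 (.N 34 (.L [131214, 6790, 10884, 39560, 54530, 65768, 65892, 69762,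
  75142, 83012, 98538, 102530, 106626, 215682, 262498, 264044, 267332, 267874, 271912, 278758,
  278882, 287810, 296172, 300420, 305798, 311526, 328040, 336962, 362022, 393450, 398722, 402820,
  426342, 460324, 492610]) (.L [131214, 6790, 9764, 10884, 39560, 44938, 54530, 65768, 65892,
  69762, 75298, 75140, 98538, 102530, 106626, 107906, 135398, 158338, 204930, 215682, 262498,
  264044, 266466, 267652, 271912, 278756, 278884, 288002, 296428, 299138, 300418, 305798, 311524,
  328040, 337442, 362022, 393450, 397442, 401538, 404098, 426342, 434306, 460324])) (.N 2 (.L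
  [131214, 6790, 34338, 34466, 36524, 38566, 39554, 43650, 55938, 65768, 65892, 69698, 69762,
  98538, 102530, 106626, 135366, 139752, 158338, 168002, 168066, 174726, 182916, 182978, 196802,
  199366, 204930, 215682, 229574, 263716, 263786, 266438, 270824, 296556, 301700, 303458, 305796,
  328040, 362022, 393450, 397378, 401892, 409666, 426216, 436866, 442434, 458818, 491586]) (.L
  [131214, 1892, 6790, 27268, 34338, 36524, 38756, 39556, 50728, 55938, 65768, 65892, 69762,
  75302, 98538, 102530, 106626, 135398, 139746, 141958, 158338, 168290, 168066, 174726, 180454,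
  204930, 215682, 232068, 262498, 262632, 266470, 271912, 296812, 299138, 301698, 305798, 328040,
  337442, 362022, 393446, 393572, 397442, 401538, 401890, 409828, 426216, 434530, 442594,
  460324]))) (.N 2 (.N 34 (.N 16 (.L [4674, 6790, 20994, 26180, 39560, 44746, 49730, 50728, 53762,
  83494, 103970, 167596, 180806, 215682, 232068, 263778, 264044, 266822, 270822, 271906, 278758,
  278882, 287810, 296172, 299074, 299522, 305798, 312388, 328040, 336962, 362022, 393450, 397378,
  402980, 426342, 426562, 434690, 460324]) (.L [3748, 6788, 7846, 22050, 23170, 39560, 44746,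
  50728, 69698, 69858, 73958, 83492, 83010, 98538, 103970, 106852, 115780, 133762, 167596, 182916,
  213058, 262498, 264044, 267330, 267876, 270822, 271906, 278758, 278882, 287810, 296172, 300578,
  305798, 312388, 328040, 336962, 362020, 361538, 393450, 397378, 402980, 426342, 460324,
  491586])) (.N 44 (.L [131150, 7850, 23172, 39560, 54658, 65768, 65892, 69698, 72322, 75142,
  83494, 98538, 103970, 114754, 135398, 164194, 199368, 215682, 262498, 264044, 266470, 270824,
  296428, 300420, 305798, 328040, 337442, 362022, 393450, 398722, 402820, 409666, 426342, 460324])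
  (.L [131150, 7850, 23172, 36520, 39560, 50728, 65768, 65892, 69698, 72322, 83494, 98538, 103970,
  114754, 135398, 156002, 166532, 167588, 166596, 168002, 172262, 199368, 215682, 232134, 263716,
  263786, 266470, 270824, 296556, 299074, 305798, 328040, 362022, 393450, 397378, 401892, 409666,
  426216, 434530, 442434, 458818, 491586]))) (.N 18 (.L [226, 7850, 12772, 23172, 39560, 49730,
  50728, 70210, 72322, 83494, 103970, 131426, 133762, 135398, 139752, 156226, 167596, 174726,
  180806, 199368, 213570, 232068, 232130, 263716, 263786, 266822, 270824, 278758, 296556, 299362,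
  305798, 328040, 362022, 393446, 393572, 397666, 401892, 409828, 426214, 426562, 436866, 442594,
  459330, 492098]) (.N 16 (.N 40 (.L [226, 4580, 6790, 13860, 20994, 21762, 26374, 39560, 44938,
  50728, 53762, 57858, 83494, 135398, 141960, 156162, 206370, 215682, 262498, 264044, 266470,
  271912, 278888, 287234, 296428, 299522, 305798, 328040, 338562, 362022, 393450, 403204, 426342,
  460324]) (.L [4580, 6790, 13860, 20994, 24802, 27268, 36524, 39560, 50728, 53762, 57858, 83494,
  103970, 131426, 131560, 135398, 141960, 156162, 174726, 182916, 206370, 215682, 262498, 262632,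
  266470, 271912, 296812, 299522, 305798, 328040, 337442, 362022, 393448, 393570, 397666, 401890,
  401922, 409826, 409954, 426216, 434530, 460324])) (.N 10 (.L [226, 3824, 7850, 13860, 23172,
  26146, 27268, 39560, 50728, 69860, 83494, 98538, 103970, 106852, 115010, 131426, 132842, 133762,
  135398, 141960, 158658, 167596, 168164, 172260, 182916, 199624, 206370, 213314, 264940, 263714,
  266468, 268930, 271912, 278754, 278886, 287074, 296812, 299330, 328040, 337442, 362022, 393450,
  397634, 401762, 401890, 409924, 426216, 434530, 442594, 460322, 459074, 491842]) (.L [3746,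
  3812, 4076, 6786, 7848, 12514, 13858, 22050, 23170, 27266, 28324, 32996, 34338, 34534, 35556,
  38760, 46818, 50728, 50914, 55938, 58916, 69860, 82148, 83490, 98538, 105090, 106852, 117476,
  131554, 132836, 133762, 133862, 135398, 140834, 141958, 158338, 167596, 168290, 168162, 174726,
  180452, 182914, 196840, 206370, 214562, 232066, 232164, 262370, 262498, 262626, 264930, 265190,
  266468, 268930, 271912, 281320, 289410, 296812, 301700, 305798, 311526, 328040, 337442, 344290,
  362022, 393448, 393570, 397666, 401762, 401890, 409826, 411362, 426216, 436866, 442594, 460324,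
  491746]))))))

theorem cert6_ok : chkCfg [7, 11, 49, 84] [4, 3, 3, 1, 3, 2, 2] cert6 = true := by decide +kernel

def cert7 : Ct :=
  .N 79 (.N 68 (.N 1 (.N 65 (.N 48 (.L [9764, 11816, 13828, 22022, 26116, 28164, 36484, 36516,
  40456, 42498, 44680, 50724, 52776, 54788, 58886, 65766, 68070, 71908, 73762, 75812, 82274,
  84198, 92290, 98660, 98534, 104482, 108676, 114722, 116772, 131302, 133606, 137444, 139298,
  141348, 147810, 149734, 157826, 164196, 164070, 170018, 174212, 180258, 182308, 229412, 271876,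
  271908, 288260, 304646, 321026, 328040, 335906, 344100, 362658, 360676, 377058, 393576, 401442,
  409636, 428194, 426212, 442594]) (.N 14 (.L [9764, 11816, 13860, 22054, 28168, 34340, 36484,
  36516, 40456, 50724, 52776, 54820, 65766, 68070, 71908, 73762, 75812, 82274, 84198, 92290,
  98660, 98534, 104482, 108676, 114722, 116772, 131302, 133606, 137444, 139298, 141348, 147810,
  149734, 157826, 164196, 164070, 170018, 174212, 180258, 182308, 213442, 229828, 273924, 271908,
  306694, 328040, 335906, 344100, 362658, 360676, 377058, 393576, 401442, 409636, 428194, 426212,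
  442594]) (.L [9764, 11816, 13860, 22054, 28168, 36484, 36516, 40456, 44682, 50724, 52776, 54820,
  65766, 68070, 71908, 73762, 75812, 82274, 84198, 92290, 98660, 98534, 104482, 108676, 114722,
  116772, 131302, 133606, 137444, 139298, 141348, 147810, 149734, 157826, 164196, 164070, 170018,
  174212, 180258, 182308, 229412, 273924, 271908, 306694, 328040, 335906, 344100, 362658, 360676,
  377058, 393576, 401442, 409636, 428194, 426212, 442594]))) (.L [262190, 9764, 11816, 13860,
  22054, 28168, 36484, 36516, 40456, 44682, 50724, 52776, 54820, 65762, 68074, 71908, 73762,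
  73956, 82274, 84198, 92290, 98660, 98534, 104578, 108676, 114722, 116900, 131298, 133610,
  137444, 139298, 139492, 147810, 149734, 157826, 164196, 164070, 170114, 174212, 180258, 182436,
  229412, 273924, 271908, 295266, 306694, 328040, 335906, 344100, 360482, 360674, 393576, 401442,
  409636, 426018, 426210])) (.N 65 (.N 6 (.N 42 (.L [9762, 11818, 13860, 22054, 36484, 36516,
  40456, 50724, 52776, 54820, 65762, 68074, 71876, 73956, 75810, 82274, 84198, 92290, 98660,
  98534, 104482, 108676, 116038, 132642, 133354, 137348, 140834, 141348, 147686, 157826, 170018,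
  182310, 196804, 197954, 230948, 273924, 271906, 328040, 337954, 346148, 362662, 377058, 403490])
  (.L [9764, 11816, 13860, 22054, 34340, 36484, 36516, 36548, 40456, 42538, 50724, 52776, 54820,
  67810, 68074, 69826, 71874, 73956, 75810, 82280, 92290, 98660, 102086, 104482, 108676, 116774,
  131300, 133608, 137412, 139490, 141348, 147814, 149730, 157826, 164196, 164066, 166084, 170018,
  182310, 198178, 196804, 229572, 273924, 271908, 306694, 327910, 328034, 337954, 346148, 360806,
  377058, 393444, 393572, 403490, 411684, 426340, 426210, 442594])) (.N 10 (.L [1570, 1772, 9764,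
  11780, 11812, 13860, 22054, 36484, 36516, 40456, 50724, 52776, 54820, 65766, 68070, 71908,
  75812, 77346, 82274, 84198, 92290, 98660, 98534, 104482, 108676, 116774, 131300, 133608, 137444,
  139490, 141348, 147810, 149734, 157826, 164196, 164070, 170018, 174212, 182310, 196930, 213314,
  230948, 271908, 274052, 290308, 328040, 337954, 346148, 360678, 393576, 403490, 411684, 426212])
  (.L [1570, 1772, 1890, 9764, 11780, 11812, 13860, 18286, 22054, 36484, 36516, 40456, 45282,
  50724, 52776, 54820, 60934, 67810, 68074, 69986, 71906, 73958, 82280, 92290, 98658, 100200,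
  104482, 108676, 116774, 131302, 133606, 137444, 141348, 142882, 147810, 149734, 157826, 164196,
  164070, 170018, 174212, 182310, 230948, 271908, 274052, 290308, 306694, 323074, 327910, 328034,
  337954, 346148, 360806, 377058, 393576, 403490, 411684, 426214]))) (.N 32 (.N 16 (.L [11820,
  12802, 13314, 22022, 28168, 36388, 36484, 39556, 40452, 44682, 45282, 52780, 53762, 54274,
  58886, 71812, 75302, 91138, 104578, 107522, 108674, 116262, 137348, 140834, 142852, 156162,
  170114, 174212, 181794, 230948, 262498, 271208, 287234, 287746, 302212, 304646, 320002, 393576])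
  (.N 10 (.L [11820, 13314, 13858, 22054, 28168, 36484, 36514, 40456, 50722, 52778, 54274, 56450,
  69954, 71810, 73958, 82280, 92290, 100586, 104578, 106850, 108674, 116038, 137348, 140838,
  157826, 170114, 181798, 196930, 230948, 262498, 263522, 271718, 273922, 300034, 302210, 327908,
  328036, 336098, 344292, 360804, 360674, 377154, 404994]) (.L [11820, 13314, 13858, 22054, 28168,
  36484, 40456, 45282, 52780, 54274, 56450, 60934, 69986, 71810, 73958, 82280, 92290, 98658,
  100584, 104578, 108676, 116262, 137348, 140838, 157826, 170114, 174212, 181794, 230948, 262498,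
  263522, 271718, 273922, 300034, 302210, 306694, 323074, 327908, 328036, 336098, 344292, 360804,
  360674, 377058, 404994]))) (.N 16 (.N 10 (.L [11820, 12802, 13858, 22054, 28168, 36484, 36514,
  40456, 50722, 52778, 53762, 55938, 71812, 75302, 92290, 104578, 116262, 135490, 137346, 139494,
  147816, 157826, 166122, 170114, 172386, 174210, 181060, 182722, 196930, 213314, 230948, 262498,
  271208, 299522, 301698, 339458, 393446, 393570, 401922, 409828, 426342, 442594]) (.L [11820,
  12802, 13858, 22054, 28168, 36484, 40456, 45282, 52780, 53762, 55938, 60934, 71812, 75302,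
  92290, 104578, 108676, 116262, 135522, 137346, 139494, 147812, 149732, 157826, 164194, 166120,
  170114, 174212, 180452, 181794, 230948, 262498, 271208, 299522, 301698, 306694, 323074, 339458,
  393442, 393574, 401922, 409828, 426338, 426212])) (.N 28 (.L [1570, 1772, 9768, 11780, 15876,
  22054, 28168, 40456, 42538, 45282, 56196, 60934, 71812, 73958, 84200, 92290, 98660, 103298,
  108676, 137348, 139494, 147812, 149732, 157826, 164196, 166118, 170114, 174212, 180452, 182498,
  200230, 230948, 264046, 271912, 283522, 290692, 295266, 306694, 328040, 336098, 393576, 401634,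
  409828, 426212]) (.L [1570, 1772, 1890, 9768, 11780, 15876, 18286, 22054, 28168, 36484, 40456,
  42536, 44674, 45282, 52780, 54820, 60934, 69986, 71810, 73958, 82280, 92290, 98658, 100584,
  104578, 108676, 137348, 139494, 147816, 157826, 164196, 166118, 170114, 174212, 181796, 182498,
  200230, 230948, 264046, 271912, 295266, 306694, 323074, 327908, 328036, 336098, 344292, 360804,
  360674, 377058, 393444, 393572, 401634, 409828, 426340, 426210, 442594])))))) (.N 4 (.N 36 (.N
  16 (.N 72 (.L [262286, 6914, 7558, 11820, 12802, 13858, 23302, 28168, 38536, 44682, 54402,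
  59014, 77574, 91266, 102530, 108932, 133478, 135524, 140838, 156162, 170242, 174468, 230948,
  266884, 267394, 271080, 283362, 286948, 336002, 393446, 393570, 401538, 409828]) (.L [262286,
  11820, 12802, 13858, 28168, 36392, 36484, 38536, 44682, 52780, 59014, 75300, 77314, 91266,
  102530, 110084, 135524, 140834, 139906, 142850, 168066, 172546, 175618, 230948, 267494, 271208,
  283362, 286948, 299652, 303458, 303746, 304258, 320002, 327912, 336002, 393576, 401538,
  409828])) (.N 65 (.L [262286, 1570, 5994, 11820, 13860, 28168, 36392, 36484, 38568, 44682,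
  52780, 69988, 73958, 82280, 92514, 100586, 102530, 107652, 116774, 135524, 141350, 165922,
  168066, 175618, 182310, 230948, 273924, 304258, 306692, 320642, 328040, 336002, 346148, 362530,
  393576, 401538]) (.L [262286, 1570, 3950, 5994, 11820, 13860, 28168, 36392, 36484, 38568, 44682,
  52780, 69988, 73956, 74882, 82146, 82278, 91266, 100842, 102530, 107652, 114914, 117218, 135524,
  140836, 142850, 168066, 175618, 200230, 230948, 271590, 273922, 283778, 286948, 295266, 300164,
  304258, 306692, 320642, 327910, 328034, 336002, 344292, 360806, 393576, 401538, 409828]))) (.N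
  20 (.L [131212, 262286, 1570, 3950, 5994, 11820, 13860, 28168, 36392, 36484, 38568, 44682,
  52780, 69988, 75300, 77314, 102530, 110082, 135524, 139494, 156002, 166378, 168066, 172676,
  180454, 200230, 230948, 266594, 266884, 271078, 273922, 283362, 286948, 299652, 303746, 306692,
  320130, 328040, 336002, 344290, 393446, 393570, 401538, 409828, 426342, 442594]) (.L [65676,
  131212, 262286, 1570, 3950, 5994, 9764, 11816, 13860, 28168, 36392, 36484, 38568, 44682, 52780,
  69988, 73958, 90466, 100842, 102530, 114918, 135524, 139494, 156002, 166378, 168066, 180454,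
  200230, 230948, 266594, 273924, 271908, 286948, 306694, 327910, 328034, 336002, 344292, 360806,
  377058, 393446, 393570, 401538, 409828, 426342, 442594]))) (.N 65 (.N 10 (.L [1570, 1772, 9768,
  11780, 15876, 22054, 28168, 40456, 50724, 52776, 54820, 60934, 65764, 68072, 71908, 73954,
  75812, 84002, 84194, 85540, 92194, 98660, 98534, 104482, 106722, 108770, 116774, 131300, 133608,
  137444, 139490, 141348, 149732, 151076, 157730, 164196, 164070, 170018, 172258, 174306, 182310,
  196930, 216578, 230948, 271912, 284194, 290628, 314884, 312868, 327906, 328038, 337954, 346146,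
  344386, 360802, 360674, 377154, 393576, 403490, 411684, 426210, 442690]) (.L [1570, 1762, 2030,
  5860, 5990, 9768, 11780, 15876, 22054, 28168, 34660, 40456, 45282, 50724, 52776, 54820, 60934,
  65764, 68072, 71908, 73954, 75812, 84196, 85540, 92194, 98660, 98534, 104482, 106722, 108770,
  116774, 131300, 133608, 137444, 139490, 141348, 149732, 151076, 157730, 164196, 164070, 170018,
  172258, 174306, 182310, 196838, 216578, 230948, 271912, 284194, 306694, 314884, 312868, 323074,
  328040, 337954, 346148, 360674, 393576, 403490, 411684, 426210])) (.N 1 (.N 72 (.L [262190,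
  9762, 11818, 13860, 22054, 28168, 50724, 52776, 54820, 60934, 68076, 69988, 73958, 85544, 92418,
  98536, 100706, 104706, 108836, 117030, 133612, 135524, 139494, 147816, 157954, 166248, 170242,
  182566, 216578, 229412, 270562, 273924, 271906, 284194, 286754, 290562, 306694, 314884, 312868,
  323074, 327910, 328034, 335906, 344100, 393448, 401442, 409636]) (.L [262190, 9762, 11818,
  13860, 22054, 28168, 40456, 52780, 54820, 60934, 68076, 69988, 73762, 73956, 85544, 90146,
  98536, 114722, 116260, 133612, 135524, 139298, 139492, 147816, 155682, 180258, 183812, 216578,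
  229412, 270690, 273924, 271906, 284194, 286756, 306694, 323074, 327908, 328036, 335906, 344100,
  360482, 360804, 376866, 393444, 393572, 401442, 409636, 426018, 426340, 442402])) (.N 2 (.N 64
  (.L [1570, 22054, 28168, 34338, 40456, 52780, 54820, 68076, 69698, 71746, 73958, 84194, 85506,
  85540, 92162, 98660, 98534, 104450, 106722, 108898, 116258, 116802, 118274, 133612, 135234,
  137282, 139494, 149732, 151076, 157698, 164196, 164070, 169986, 172258, 181794, 182340, 213058,
  230946, 229442, 284194, 306694, 314952, 323074, 327906, 328038, 336098, 344292, 376898, 393576,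
  401634, 409828, 445954]) (.L [1570, 22054, 28168, 34338, 40456, 52780, 68076, 69698, 69986,
  73958, 85544, 90466, 98658, 98534, 116262, 133612, 135234, 135522, 139494, 147814, 151042,
  156002, 164194, 181794, 183812, 200230, 213058, 230946, 229442, 270690, 284194, 286948, 306694,
  314952, 323074, 327910, 328034, 336098, 344130, 344290, 360806, 376898, 393444, 393572, 401634,
  409828, 426340, 442434])) (.N 32 (.N 6 (.L [15876, 22054, 40456, 44746, 52780, 54274, 54818,
  68076, 69988, 73956, 75298, 82280, 90338, 107522, 115910, 140838, 151080, 181798, 196804,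
  216578, 230948, 262372, 263402, 271714, 273922, 271908, 284194, 287746, 295266, 296294, 296132,
  300034, 306694, 314884, 328040, 336066, 344292, 360644, 404994]) (.L [13314, 15874, 22054,
  40456, 45282, 52780, 54274, 60934, 68076, 69860, 75298, 77348, 82146, 82278, 91138, 98660,
  98530, 107522, 116262, 140838, 151080, 159234, 181794, 183812, 216578, 230948, 262372, 263402,
  273922, 271910, 283650, 290308, 295266, 296296, 300034, 306694, 320514, 327908, 328036, 336098,
  344292, 360804, 404994, 411170])) (.N 74 (.L [1570, 3824, 15876, 22054, 28168, 32994, 34542,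
  40456, 42538, 52780, 54820, 67308, 69988, 73956, 75298, 82146, 85542, 92514, 100842, 102626,
  106724, 114914, 116258, 117058, 135524, 139492, 140834, 147814, 151074, 155874, 166378, 168162,
  174436, 181794, 183812, 200230, 216578, 230948, 271912, 284194, 286948, 315208, 323074, 327910,
  328034, 339458, 344292, 360806, 379202, 393448, 404994, 409826, 411970, 426340, 426210, 444738])
  (.L [1570, 3824, 15876, 22054, 28168, 32994, 34542, 40456, 42538, 52780, 54820, 60934, 67308,
  69988, 73954, 75300, 82146, 82274, 85540, 90338, 100842, 102626, 110084, 114916, 116258, 135524,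
  139490, 140836, 147682, 147810, 151076, 155874, 166378, 168162, 172258, 175618, 180450, 181794,
  183810, 200230, 216578, 230948, 264046, 271912, 284194, 286948, 295266, 314882, 323074, 327910,
  328034, 339458, 344292, 360806, 377058, 393446, 393570, 404994, 409828, 426342, 442594]))))))))
  (.N 36 (.N 16 (.N 34 (.L [262638, 266726, 270824, 278890, 282978, 287076, 295148, 299236,
  303334, 311528, 319714, 5186, 12802, 34370, 36392, 36418, 36484, 38536, 44682, 45282, 52780,
  53762, 58950, 101956, 169090, 230948, 328040, 336098, 344292, 360678, 377058, 393576, 402562,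
  409828, 426214, 443458]) (.L [262638, 266726, 270824, 278890, 282978, 287076, 295148, 299236,
  303334, 311528, 319714, 11820, 12802, 13858, 28168, 36392, 36484, 38536, 44682, 45282, 52780,
  53762, 59014, 75302, 91266, 110084, 135524, 156162, 169090, 172546, 175618, 230948, 328040,
  336098, 344292, 360678, 377058, 393576, 402562, 409828, 426214, 442594])) (.L [262638, 266726,
  270824, 278890, 282978, 287076, 295148, 299236, 303334, 311528, 319714, 1570, 3950, 5994, 11820,
  13860, 28168, 36392, 36484, 38568, 44546, 44680, 45282, 52780, 60930, 69858, 69986, 73956,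
  74882, 82280, 91266, 98658, 107652, 135524, 140836, 142850, 169090, 175620, 200230, 230948,
  328040, 336098, 344292, 360678, 377058, 393576, 402562, 409828, 426214, 442594])) (.N 4 (.L
  [131212, 262638, 266726, 270824, 278890, 282978, 287076, 295148, 299236, 303334, 311528, 319714,
  1570, 3950, 5994, 11820, 13860, 28168, 36392, 36484, 38568, 44682, 52780, 65764, 69988, 73954,
  75300, 82280, 102530, 110084, 135524, 139494, 164072, 168066, 175618, 200230, 230948, 328040,
  336002, 344292, 360678, 377058, 393576, 401538, 409828, 426214, 442594]) (.N 44 (.L [262638,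
  266726, 270824, 278890, 282978, 287076, 295148, 299236, 303334, 311528, 319714, 482, 3824, 5994,
  9964, 13860, 22054, 28168, 36718, 40456, 44546, 44936, 60930, 65766, 66020, 67106, 69988, 75300,
  77314, 85544, 91522, 98532, 107908, 131302, 135524, 142850, 142884, 169346, 175620, 200230,
  216578, 230948, 328040, 336098, 344292, 360678, 377058, 393576, 401634, 409828, 426214, 442594])
  (.L [262638, 266726, 270824, 278890, 282978, 287076, 295148, 299236, 303334, 311528, 319714,
  4082, 5666, 5864, 9762, 9954, 11816, 13858, 16098, 22054, 28168, 32994, 34542, 40456, 42532,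
  44550, 48642, 52780, 54820, 60934, 69356, 69860, 75298, 77316, 85544, 90338, 98658, 98536,
  102754, 108068, 116260, 118274, 132834, 135018, 135396, 140834, 142884, 155874, 164194, 164072,
  168290, 173602, 175650, 200230, 216578, 230948, 328040, 336098, 344292, 360678, 377058, 393576,
  401634, 409828, 426214, 442594, 458978]))))

theorem cert7_ok : chkCfg [7, 11, 49, 112] [4, 3, 2, 1, 3, 3, 2] cert7 = true := by decide +kernel

def cert8 : Ct :=
  .N 12 (.N 3 (.L [6020, 10116, 22146, 26242, 38658, 42754, 66020, 70018, 74114, 82018, 98402,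
  131556, 135554, 139650, 147554, 163938, 196706]) (.L [1764, 1890, 6020, 10116, 22146, 26242,
  34658, 38658, 42754, 66020, 70018, 74114, 82146, 98658, 131556, 135554, 139650, 147682,
  164194])) (.N 4 (.N 2 (.L [32900, 6020, 22146, 38658, 66020, 69826, 74082, 98498, 131556,
  135362, 139618, 164034]) (.L [32900, 1892, 6020, 22146, 26242, 38658, 42754, 66020, 69858,
  75650, 98658, 131556, 135394, 141186, 164194])) (.N 5 (.L [5988, 10116, 26242, 38658, 42754,
  66020, 69858, 74082, 83714, 98466, 131556, 135394, 139618, 164002]) (.N 34 (.L [1922, 6020,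
  12770, 38658, 66020, 70722, 74082, 82146, 136834]) (.L [2022, 5858, 6018, 10116, 12770, 26242,
  34660, 38658, 42754, 66020, 71554, 73954, 83714, 98658, 131556, 136834, 147682, 164194,
  196834]))))

theorem cert8_ok : chkCfg [7, 11, 52, 56] [1, 1, 1, 1, 1, 1, 0] cert8 = true := by decide +kernel

def cert9 : Ct :=
  .N 12 (.N 80 (.N 48 (.L [8072, 12168, 15876, 24068, 27138, 28162, 40452, 44548, 66024, 70020,
  74116, 82148, 98660, 131298, 131426, 131558, 137094, 141190, 144898, 151938, 156034, 169474,
  173570, 202370, 206466, 262370, 262498, 262630, 266626, 269188, 273286, 276994, 285186, 287106,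
  301954, 305666, 334594, 337538, 393704, 397700, 401796, 409828, 426340]) (.N 32 (.L [66568,
  8072, 12168, 14850, 15874, 22146, 23042, 27138, 28162, 39810, 40450, 44548, 69860, 74084, 82276,
  98532, 137094, 141190, 145922, 151938, 157314, 170498, 172418, 201058, 205154, 229730, 262498,
  262630, 263522, 269186, 267652, 273286, 274658, 279780, 283010, 287106, 296290, 301954, 305666,
  334594, 337538, 393704, 398980, 401796]) (.L [1764, 8072, 12168, 14850, 24196, 27138, 28290,
  38532, 42628, 66024, 70020, 74116, 82148, 98660, 137090, 137988, 141026, 142084, 145922, 147682,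
  147812, 151938, 156034, 166758, 168290, 173698, 180450, 202370, 206466, 232290, 262498, 262628,
  266722, 269188, 273286, 274658, 283010, 287106, 301954, 305666, 334594, 337538, 393704, 397700,
  401796, 409828, 426340]))) (.N 48 (.N 64 (.L [67592, 8072, 12168, 15876, 24068, 28164, 40452,
  44548, 69860, 74084, 82276, 98532, 131298, 131426, 131558, 137094, 141190, 144898, 149732,
  151938, 156034, 166244, 169474, 173570, 202370, 206466, 269190, 273286, 283010, 287106, 301826,
  305922, 332002, 336098, 344290, 393704, 397700, 401796]) (.L [2916, 8072, 12168, 13826, 22404,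
  27396, 40708, 44804, 66024, 70020, 74116, 82148, 98660, 131426, 131554, 135652, 137090, 141190,
  143586, 151938, 156034, 169474, 173570, 202370, 206466, 269188, 267906, 273250, 272004, 274658,
  280294, 283010, 287106, 295266, 295140, 301954, 305922, 311522, 334594, 336258, 344290, 393704,
  397700, 401796, 409828, 426340, 458978])) (.N 112 (.L [1766, 2918, 8072, 12168, 15876, 24068,
  28164, 40452, 44548, 66024, 70020, 74116, 82148, 98660, 131426, 131558, 136834, 137092, 140930,
  141188, 143586, 151938, 156034, 169602, 173698, 201058, 205154, 229730, 262498, 262630, 269058,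
  269188, 273286, 274658, 283010, 287106, 301954, 305922, 332002, 336098, 344290, 393704, 397700,
  401796, 409828, 426340]) (.L [1766, 2918, 8072, 12168, 22404, 26500, 39812, 43908, 66024, 70020,
  74116, 82148, 98660, 131298, 133992, 136834, 137988, 140930, 142084, 143714, 147814, 151938,
  156034, 169602, 173698, 201058, 205154, 229730, 262370, 263912, 269186, 267908, 273282, 272004,
  274786, 278886, 283010, 287106, 301826, 305922, 332002, 336098, 344290, 393704, 397700, 401796,
  409828, 426340])))) (.N 4 (.N 5 (.N 2 (.N 17 (.L [32904, 37540, 42628, 98500, 131298, 133992,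
  135654, 140134, 143714, 164518, 168066, 172162, 181890, 197218, 199460, 229922, 262370, 263912,
  266726, 271014, 274786, 279074, 280260, 299138, 303234, 331842, 336002, 393704, 397508, 401764,
  410148, 426148, 459364]) (.L [32904, 6914, 38530, 42628, 66024, 74084, 82148, 98468, 131298,
  133992, 135650, 137988, 139618, 142084, 143842, 147810, 165540, 165570, 168066, 172162, 181890,
  196966, 200770, 229442, 262370, 263912, 266726, 274786, 299138, 303234, 327910, 331842, 336002,
  344226, 393704, 397508, 401764, 411300, 426148, 458948])) (.N 40 (.L [32904, 2918, 6914, 27396,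
  40708, 44804, 66024, 69860, 74084, 98468, 141190, 143490, 156930, 174978, 196966, 201986,
  204930, 262370, 263912, 266726, 273154, 271748, 274786, 289538, 296292, 299138, 303234, 327910,
  331906, 336002, 393704, 397540, 403076, 411044, 458916]) (.L [32904, 2918, 6914, 27396, 38532,
  42628, 66024, 69860, 74084, 98468, 131298, 133992, 135652, 137986, 142214, 143714, 147810,
  157314, 168066, 172162, 181890, 196966, 203522, 207746, 229538, 262370, 263912, 266726, 273154,
  272004, 274786, 289538, 299138, 303234, 327910, 331906, 336002, 393704, 397540, 401764, 411300,
  426148]))) (.N 2 (.L [4232, 32904, 38532, 66024, 72450, 72578, 74084, 82148, 98500, 131298,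
  133992, 137988, 138114, 139750, 143714, 153218, 165574, 168066, 172162, 181890, 196966, 200770,
  229442, 262370, 263912, 269186, 267908, 270822, 274786, 285442, 299138, 303234, 327910, 331842,
  336002, 393704, 397508, 401764, 411332, 426180, 461636]) (.L [4232, 32904, 2918, 27396, 38532,
  42628, 66024, 72450, 72578, 74084, 82148, 131298, 133992, 137986, 138116, 142214, 143714,
  147814, 153218, 157314, 168066, 172162, 181890, 196966, 203522, 207746, 262370, 263912, 269186,
  267908, 273154, 272004, 274786, 278886, 285442, 289538, 299138, 303234, 327910, 331906, 336002,
  393704, 400260, 404228, 409828, 426340]))) (.N 1 (.N 9 (.N 2 (.L [23300, 27396, 34434, 66024,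
  69860, 74020, 82212, 102276, 131298, 133992, 135654, 139554, 142084, 151842, 165574, 180290,
  196966, 200770, 229410, 263842, 263912, 266726, 270626, 272004, 274658, 281346, 281378, 280226,
  282914, 289538, 311362, 327910, 331842, 344098, 393704, 397540, 401700, 409892, 428836, 458852])
  (.L [27396, 42628, 66024, 69860, 74020, 82212, 102276, 131298, 133992, 135654, 143238, 143650,
  151842, 157314, 166692, 173698, 181890, 196966, 200994, 204834, 262370, 263912, 266726, 272004,
  274306, 274722, 281382, 282914, 289538, 305922, 314114, 327910, 335906, 344098, 393704, 397540,
  404228, 409892, 426340, 460452])) (.N 18 (.L [32808, 27396, 42628, 85892, 99970, 100034, 131298,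
  133992, 135654, 140134, 143714, 165542, 172610, 180258, 197218, 199492, 229410, 262370, 263912,
  266726, 271078, 274786, 281382, 287298, 311330, 328290, 329412, 344098, 393704, 397540, 401764,
  411300, 428836, 459364]) (.L [32808, 3970, 12168, 27396, 42628, 66024, 69860, 84738, 85890,
  98660, 131298, 133992, 135654, 139618, 142084, 157314, 165506, 165540, 169602, 173698, 180258,
  196966, 204834, 229410, 262370, 263912, 266726, 270690, 272004, 281382, 289538, 305922, 311330,
  327910, 335906, 344098, 393704, 397540, 401764, 411300, 428836]))) (.N 2 (.N 8 (.L [22402,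
  23298, 40836, 66024, 71554, 73602, 73956, 82244, 98660, 131298, 133992, 136834, 137988, 139750,
  143618, 151810, 155906, 169602, 196966, 200770, 205058, 262370, 263912, 267908, 268162, 270822,
  274690, 281414, 282882, 286978, 301826, 314114, 327910, 331842, 344130, 393704, 397540, 401764,
  409924, 428868, 460484]) (.L [3972, 23300, 38532, 66024, 73604, 73954, 74082, 82146, 84738,
  98658, 99970, 131298, 133992, 137988, 139138, 139750, 143714, 153218, 165574, 169602, 180290,
  196966, 200770, 229442, 262370, 263912, 267908, 270210, 270822, 274786, 281414, 285442, 301826,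
  311362, 327910, 331842, 344130, 393704, 397540, 401764, 411332, 428868])) (.N 8 (.N 17 (.L
  [21284, 26500, 44932, 77700, 131298, 133992, 135654, 140930, 142084, 143618, 151810, 155906,
  164710, 168482, 173698, 205346, 262370, 263912, 266726, 271074, 272004, 274690, 279334, 282882,
  286978, 305922, 314114, 327908, 336418, 344610, 393704, 397540, 401764, 410148, 426532]) (.L
  [1766, 23300, 27396, 38530, 40834, 42628, 66024, 73956, 98660, 131298, 133992, 136834, 137090,
  139138, 140930, 142084, 143618, 147814, 151810, 155906, 169602, 173698, 196966, 200962, 205058,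
  262370, 263912, 267906, 268164, 272262, 274690, 278886, 282882, 286978, 301826, 305922, 314114,
  327910, 333442, 337794, 393704, 400132, 403076, 409828, 426340])) (.N 97 (.L [1766, 2918, 12772,
  23300, 27396, 38532, 42628, 66024, 69860, 74084, 85892, 99970, 133098, 135654, 142084, 143234,
  143586, 153218, 157314, 168290, 173698, 183330, 196966, 207906, 265194, 266726, 274310, 274658,
  285442, 289538, 299362, 305922, 314114, 327910, 334594, 338978, 403076]) (.L [4076, 12772,
  23300, 27396, 38532, 42628, 66024, 69860, 77700, 85892, 98660, 133098, 137988, 139138, 141028,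
  142082, 143586, 147814, 153218, 157314, 164194, 166756, 169602, 173698, 181890, 196966, 204674,
  207618, 213218, 232290, 265194, 267908, 270210, 273252, 272002, 274658, 278882, 280292, 285442,
  289538, 295266, 295140, 300674, 305922, 314114, 327910, 334594, 337538, 345826, 360802, 393704,
  405380, 409828, 426340, 458978, 459106]))))))

theorem cert9_ok : chkCfg [7, 11, 52, 88] [2, 2, 2, 2, 2, 1, 1] cert9 = true := by decide +kernel

def cert10 : Ct :=
  .N 124 (.N 79 (.N 4 (.N 76 (.N 48 (.N 67 (.L [8078, 12174, 13828, 22022, 26118, 38402, 38536,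
  42498, 42632, 54786, 58882, 68078, 72072, 76168, 78178, 82150, 98538, 102532, 106628, 117122,
  133614, 137608, 141704, 143714, 147686, 164074, 168068, 172164, 182658, 204290, 208386, 229508,
  267914, 272010, 285058, 289154, 300550, 304646, 329826, 327912, 331908, 336004, 344290, 360806,
  395362, 393448, 397444, 401540, 409826, 426342]) (.L [8078, 12174, 15880, 22022, 26118, 38402,
  38536, 42498, 42632, 54786, 58882, 65890, 68076, 72072, 76168, 79362, 82150, 98538, 102532,
  106628, 117122, 131426, 133612, 137608, 141704, 144898, 147686, 164074, 168068, 172164, 182658,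
  204290, 208386, 229508, 262372, 267914, 272010, 285058, 289154, 300550, 304646, 327914, 331908,
  336004, 344418, 360806, 393450, 397444, 401540, 409954, 426342])) (.N 67 (.L [8078, 12174,
  22150, 26246, 34436, 38538, 42634, 55682, 59778, 68078, 72072, 76168, 78178, 82150, 98538,
  102532, 106628, 117122, 133614, 137608, 141704, 143714, 147686, 164074, 168068, 172164, 182658,
  201058, 205154, 229732, 269826, 267912, 273922, 272008, 284290, 288386, 302598, 306694, 329826,
  327912, 331908, 336004, 344290, 360806, 395362, 393448, 397444, 401540, 409826, 426342]) (.L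
  [8078, 12174, 15880, 22150, 26246, 34436, 38538, 42634, 55682, 59778, 68078, 72072, 76168,
  78178, 82150, 98538, 102532, 106628, 117122, 133614, 137608, 141704, 143714, 147686, 164074,
  168068, 172164, 182658, 201058, 205154, 229732, 262372, 269826, 267912, 273922, 272008, 284290,
  288386, 298860, 302598, 306694, 327914, 331908, 336004, 360806, 393450, 397444, 401540,
  426342]))) (.N 68 (.N 40 (.L [34960, 51336, 295052, 8078, 12174, 15880, 22150, 26246, 38538,
  42634, 55426, 59522, 68078, 71016, 78178, 82150, 98538, 102532, 106628, 138632, 142728, 147686,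
  168068, 172164, 267914, 272010, 300390, 306694, 327914, 331908, 336004, 360806, 393450, 397444,
  401540]) (.L [34960, 51336, 295052, 3948, 8078, 12174, 15880, 22150, 26246, 38538, 42634, 55426,
  59522, 68078, 78178, 82150, 98538, 102532, 106628, 116866, 133614, 135656, 143714, 147686,
  168068, 172164, 180450, 196968, 229508, 267914, 272010, 302598, 306694, 327914, 331908, 336004,
  360806, 393450, 397444, 401540, 426342])) (.N 65 (.L [262288, 295052, 12174, 15880, 22150,
  26246, 38538, 42634, 55330, 68078, 70118, 75810, 78178, 82150, 98532, 100518, 102532, 106628,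
  116770, 133614, 141346, 143714, 147686, 164074, 168068, 172164, 182306, 196968, 208386, 229508,
  272010, 302598, 306694, 327914, 331908, 336004, 360806, 393450, 397444, 401540, 426342]) (.L
  [262288, 295052, 3948, 8078, 12174, 15880, 22150, 26246, 38536, 40450, 42634, 54914, 68078,
  73352, 78178, 82150, 98538, 102532, 106628, 133614, 143714, 147686, 164074, 168068, 172164,
  196968, 204290, 208386, 229508, 272010, 274564, 284290, 299138, 302596, 306694, 327914, 331908,
  336004, 360806, 393450, 397444, 401540, 426342])))) (.N 12 (.N 76 (.N 68 (.L [1772, 8078, 12174,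
  15880, 22150, 26246, 38538, 42634, 55426, 59522, 68078, 72072, 76168, 78178, 82150, 98538,
  102788, 106884, 116866, 133614, 137608, 141704, 143714, 147686, 164074, 168324, 172420, 182402,
  196968, 204290, 208386, 267914, 272010, 298860, 302598, 306694, 327914, 333956, 338052, 360806,
  393450, 399492, 403588, 426342]) (.N 66 (.L [1772, 8078, 15880, 22150, 26246, 38538, 42634,
  55682, 68078, 72072, 76168, 78178, 82150, 98538, 102788, 106884, 117122, 133614, 137608, 141704,
  143714, 147686, 164074, 168324, 172420, 182658, 196968, 204290, 267914, 302598, 306694, 327914,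
  333890, 346178, 360806, 393450, 399426, 411714, 426342, 460420]) (.L [1772, 8078, 12174, 15880,
  22150, 26246, 38538, 42634, 55682, 59778, 68078, 72072, 76168, 78178, 82150, 98538, 102788,
  106884, 117122, 133614, 137608, 141704, 143714, 147686, 164074, 168324, 172420, 182658, 196968,
  204290, 208386, 263920, 267914, 274660, 298860, 302598, 306694, 327914, 337540, 360806, 393450,
  403076, 426342, 460420]))) (.L [262544, 278920, 295308, 1764, 3824, 8078, 12174, 15880, 22150,
  26246, 36716, 38538, 42634, 68078, 71400, 78178, 82150, 98538, 102788, 106884, 133614, 143714,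
  147686, 164074, 168324, 172420, 196968, 204290, 208386, 267914, 272010, 274660, 302598, 306694,
  327914, 332164, 336260, 360806, 393450, 397700, 401796, 426342, 460420])) (.N 68 (.N 76 (.N 40
  (.L [1772, 8078, 12174, 15880, 22150, 26246, 38538, 42634, 45284, 54530, 58626, 68078, 72068,
  73218, 73474, 76168, 78178, 82150, 98538, 104580, 107778, 107874, 116866, 137608, 141704,
  147686, 171524, 196966, 201986, 208386, 267914, 272010, 285058, 289154, 300390, 306694, 327914,
  333956, 338052, 360806, 393450, 399492, 403588]) (.L [1772, 8078, 12174, 15880, 22150, 26246,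
  34544, 38538, 42634, 45284, 55426, 59522, 68078, 72072, 76168, 78178, 82150, 98538, 116866,
  133614, 137608, 141704, 143714, 147686, 168164, 172260, 180450, 196968, 204290, 208386, 231044,
  267914, 272010, 298860, 302598, 306694, 327914, 333956, 338052, 360806, 393450, 399492, 403588,
  426342])) (.L [34960, 297100, 484, 2032, 8078, 12174, 15880, 22150, 26246, 38538, 42634, 55426,
  59522, 68078, 71400, 75492, 78178, 82150, 98538, 104580, 108676, 116866, 133614, 147686, 164074,
  170116, 174212, 196968, 231044, 266092, 267914, 272010, 302598, 306694, 327914, 333956, 338052,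
  360806, 393450, 399492, 403588, 426342])) (.N 32 (.N 104 (.N 2 (.N 65 (.N 20 (.L [22150, 27910,
  35496, 38538, 42634, 55330, 60674, 67682, 71016, 78178, 103044, 107140, 150822, 183554, 230020,
  285954, 295624, 336516, 360806]) (.L [5766, 23588, 23810, 27910, 38538, 42634, 54274, 60674,
  68078, 70722, 71014, 73958, 74082, 79906, 98538, 103426, 103490, 107522, 114754, 150786, 150820,
  180290, 200770, 231044, 285954, 287746, 313378, 311362, 327914, 346146, 360806, 409666])) (.L
  [8078, 15880, 23814, 27910, 38538, 42634, 54274, 58370, 68078, 70722, 71302, 74082, 75110,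
  78850, 82150, 98538, 103426, 103490, 107522, 114754, 138888, 150786, 150850, 180290, 204290,
  231044, 271594, 274660, 283650, 287746, 302598, 311362, 327914, 331842, 333442, 344130, 360806,
  397378, 409666])) (.N 1 (.L [15880, 23814, 26244, 27906, 38538, 42634, 54274, 58370, 68078,
  71016, 75394, 77702, 78850, 82150, 98538, 102754, 103426, 107522, 110210, 114722, 142850,
  143238, 150786, 150818, 180258, 204834, 231044, 267498, 272010, 274660, 283650, 287746, 306694,
  311330, 327914, 335906, 344098, 360806, 401442, 409634]) (.L [15880, 23814, 27910, 38538, 42634,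
  45284, 54274, 58370, 68078, 71302, 71010, 75396, 77700, 78850, 82150, 98538, 106116, 106850,
  107522, 138888, 142850, 143238, 171652, 175748, 183554, 196966, 204290, 206466, 231044, 262370,
  267498, 272010, 274658, 275458, 283650, 287746, 302598, 306694, 327914, 335748, 360806, 398978,
  401282]))) (.N 40 (.L [263440, 295948, 394506, 8078, 12174, 15880, 22150, 26246, 38538, 42634,
  45284, 54274, 58370, 68078, 71016, 77314, 78178, 82150, 98538, 105988, 138888, 171522, 201986,
  206082, 267498, 272010, 274660, 284290, 287746, 300390, 306694, 327914, 332802, 360806, 410882])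
  (.L [33808, 295948, 8078, 12174, 15880, 22150, 26246, 38538, 42634, 45284, 54274, 58370, 68078,
  71016, 74082, 78850, 82150, 98538, 105988, 107522, 138888, 171522, 204290, 208386, 231044,
  267498, 272010, 274660, 284290, 287746, 300390, 306694, 312322, 327914, 360806]))) (.N 16 (.N 88
  (.N 2 (.L [5764, 8074, 15880, 22146, 23300, 27398, 38538, 42634, 53762, 57858, 73352, 84738,
  84802, 106116, 114754, 135746, 136038, 141800, 143874, 147686, 164074, 168450, 170466, 172386,
  172546, 180290, 196962, 204290, 231044, 266986, 274660, 283138, 287234, 302598, 311362, 331842,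
  333442, 344130, 393450, 397378, 397794, 401890, 409666, 426342]) (.L [5764, 8074, 15880, 23302,
  26242, 27396, 38538, 42634, 45284, 53762, 57858, 73352, 77704, 106116, 110212, 117506, 136834,
  136038, 140930, 141798, 143874, 147686, 164074, 168450, 170466, 172386, 172546, 182754, 196962,
  204290, 206466, 231044, 262370, 266986, 272010, 274658, 274946, 283138, 287234, 302598, 306694,
  333442, 339458, 339842, 393450, 397796, 426342])) (.N 5 (.L [295436, 12174, 15880, 26246, 33444,
  34466, 38536, 40450, 42634, 57858, 105988, 136040, 141800, 143714, 147686, 164074, 168100,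
  174564, 182754, 204290, 208386, 231044, 266986, 272010, 274596, 287234, 299878, 306694, 311972,
  331940, 393450, 397476, 426342]) (.L [295436, 8078, 12174, 15880, 26246, 38538, 42634, 45284,
  53762, 57858, 73352, 105988, 136838, 136034, 141800, 143874, 147686, 164074, 168450, 170466,
  172386, 172546, 182754, 196966, 204290, 208386, 231044, 262370, 263010, 266986, 272010, 274658,
  274946, 283138, 287234, 299876, 302594, 306694, 311810, 333442, 393450, 397794, 426342]))) (.N 1
  (.N 24 (.L [12174, 15880, 21252, 25346, 26244, 42634, 58114, 75394, 77314, 82150, 136040,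
  141800, 143714, 147686, 164074, 170468, 182754, 201474, 205570, 272010, 274660, 283394, 287490,
  299878, 306694, 312100, 327914, 335906, 344834, 393450, 401442, 409634, 426342, 460420]) (.L
  [12174, 15880, 26246, 34434, 38538, 42634, 70120, 76264, 78178, 82150, 104932, 106722, 109026,
  114722, 137704, 139618, 141798, 147686, 164074, 180258, 196968, 204834, 229410, 231042, 272010,
  274660, 302598, 306694, 311330, 327914, 335906, 339458, 344098, 360806, 393450, 401442, 409634,
  426342, 460420])) (.N 2 (.L [15880, 22150, 34434, 38538, 42634, 56834, 72168, 74082, 76262,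
  82150, 98538, 106116, 114754, 137704, 139618, 141798, 147686, 164074, 171652, 180290, 196968,
  204290, 229442, 231042, 267914, 274660, 302598, 306694, 311362, 327914, 335748, 344130, 360806,
  393450, 397378, 409666, 426342, 460420]) (.L [1772, 15880, 22150, 26246, 34544, 38538, 42634,
  45284, 56834, 60930, 72168, 77704, 78178, 82150, 98538, 104932, 110212, 117218, 137704, 139618,
  141798, 147686, 164074, 171652, 196968, 204290, 208386, 231044, 263920, 267914, 272010, 274660,
  298860, 302598, 306694, 327914, 335748, 360806, 393450, 401284, 426342, 460420])))))))) (.N 32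
  (.N 12 (.N 3 (.L [262640, 266730, 270826, 274820, 278888, 282978, 287074, 295148, 299238,
  303334, 311396, 8078, 12174, 22150, 26246, 38536, 40450, 42632, 44546, 54274, 58370, 66660,
  66920, 70020, 71042, 73346, 74114, 77446, 78178, 82022, 98538, 103426, 105986, 106882, 107522,
  138888, 139650, 141186, 142980, 168322, 171522, 175620, 204290, 208386, 327914, 332164, 336260,
  344450, 360550, 393450, 397700, 401796, 409986, 426086]) (.L [262640, 266730, 270826, 274820,
  278888, 282978, 287074, 295148, 299238, 303334, 311524, 8078, 12174, 22150, 26246, 38536, 40450,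
  42632, 44546, 54274, 58370, 65890, 66920, 70020, 71042, 73346, 74114, 77446, 78850, 82150,
  98538, 103426, 105986, 106882, 107522, 138888, 139650, 141186, 142980, 146946, 168322, 171522,
  175620, 204290, 208386, 327914, 332164, 336260, 344450, 360806, 393450, 397700, 401796, 409986,
  426342])) (.N 8 (.L [16652, 262640, 266730, 270826, 274916, 278888, 282978, 287074, 295148,
  299238, 303334, 311524, 8078, 12174, 15880, 22150, 26246, 38538, 42634, 54274, 58370, 65890,
  71016, 77448, 78850, 82150, 98538, 105988, 138888, 142850, 143110, 171522, 200962, 205058,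
  327914, 332260, 336356, 344322, 360806, 393450, 397796, 401892, 409858, 426342]) (.L [262640,
  266730, 270826, 274916, 278888, 282978, 287074, 295148, 299238, 303334, 311524, 8078, 12174,
  15880, 22150, 26246, 38538, 42634, 45284, 54274, 58370, 71016, 77448, 78178, 82150, 98538,
  105988, 110084, 138888, 142978, 171522, 175618, 204290, 208386, 231044, 327914, 332260, 336356,
  344418, 360806, 393450, 397796, 401892, 426342]))) (.N 24 (.L [262640, 266730, 270826, 274916,
  278888, 282978, 287074, 295148, 299238, 303334, 311524, 484, 3824, 8078, 12174, 15880, 18156,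
  22150, 25346, 26244, 38538, 42634, 54018, 58114, 73352, 77448, 82150, 105988, 110084, 136038,
  138754, 140930, 142850, 142978, 143106, 144130, 147686, 164074, 168706, 171522, 172386, 204418,
  205570, 327914, 332260, 336356, 344834, 360806, 393450, 397796, 401892, 409954, 426342, 460420])
  (.L [262640, 266730, 270826, 274916, 278888, 282978, 287074, 295148, 299238, 303334, 311524,
  484, 3824, 7810, 8076, 12174, 15880, 18156, 22150, 26246, 34544, 38538, 42634, 56834, 65890,
  69484, 70120, 77448, 78306, 82150, 105988, 110084, 138888, 142978, 143714, 147686, 164074,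
  171522, 175618, 196968, 204290, 208386, 231044, 327914, 332260, 336356, 344418, 360806, 393450,
  397796, 401892, 409954, 426342, 460420])))) (.N 79 (.N 1 (.N 68 (.N 2 (.L [36496, 52744, 102026,
  118274, 167562, 183810, 231556, 296588, 312964, 362118, 427654, 38538, 42634, 55426, 59522,
  68078, 70120, 74210, 75908, 75938, 78178, 82022, 104580, 108676, 133614, 135656, 139746, 141444,
  141474, 143714, 147558, 170116, 174212, 196968, 200770, 204834, 302598, 306694, 327912, 328034,
  333954, 332130, 335906, 336226, 344098, 393448, 393570, 399490, 397666, 401442, 401762, 409634])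
  (.L [36496, 52744, 102026, 118274, 167562, 183810, 231556, 296588, 312964, 362118, 427654,
  15880, 26246, 38538, 42634, 55426, 59522, 68078, 70120, 74210, 75908, 75938, 78178, 82150,
  104580, 108676, 133614, 135656, 139746, 143714, 147686, 170116, 174212, 196968, 208386, 272010,
  302598, 306694, 327912, 328034, 333956, 335906, 336226, 393450, 399492, 403588])) (.N 64 (.L
  [18444, 36496, 52744, 102026, 118274, 167562, 183810, 233092, 296588, 312964, 362118, 427654,
  15880, 26246, 38538, 42634, 55298, 59394, 68078, 70120, 74082, 76134, 78306, 82150, 106116,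
  110212, 133614, 135656, 139618, 141670, 143842, 147686, 171652, 175748, 196968, 206850, 272010,
  302598, 306694, 327914, 335906, 344098, 393450]) (.L [36496, 52744, 102026, 118274, 167562,
  183810, 233092, 296588, 312964, 362118, 427654, 15880, 26246, 38538, 42634, 56834, 60930, 68078,
  70120, 74210, 78178, 82150, 106116, 110212, 133614, 135656, 139746, 143714, 147686, 171652,
  175748, 196968, 208386, 272010, 274660, 302598, 306694, 327914, 332132, 335906, 336226, 393450,
  397668, 460420]))) (.N 65 (.L [36496, 52744, 102026, 118274, 167562, 183810, 233092, 296588,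
  312964, 362118, 427654, 484, 2032, 15880, 18156, 22150, 26246, 38538, 42634, 55330, 60930,
  68078, 70120, 73954, 74082, 76132, 78306, 82148, 84002, 106116, 110212, 133614, 135656, 139618,
  141670, 143842, 147686, 171652, 175748, 196968, 208386, 272010, 302598, 306694, 327914, 332130,
  337954, 346146, 393450, 403490, 411682, 460420]) (.L [36496, 52744, 102026, 118274, 167562,
  183810, 233092, 296588, 312964, 362118, 427654, 484, 2032, 11778, 12140, 15880, 18156, 22150,
  26246, 38538, 42634, 56834, 60930, 68078, 70114, 73350, 74216, 78178, 82150, 106116, 110212,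
  133614, 135654, 138882, 139748, 143714, 147686, 171652, 175748, 196968, 204290, 263920, 272010,
  274660, 284290, 302598, 306694, 327914, 332132, 336226, 393450, 397668, 401762, 460420]))) (.N
  17 (.L [36496, 52744, 102026, 118274, 167562, 183810, 233092, 262640, 266730, 270826, 274916,
  278888, 282978, 287074, 295148, 299238, 303334, 311524, 362118, 427654, 8676, 11914, 15880,
  26246, 38538, 42634, 53794, 60930, 105988, 110084, 131562, 134788, 136040, 139812, 143714,
  147686, 171652, 175748, 208386, 327914, 332132, 336356, 344610, 393450, 397668, 401892, 409954])
  (.L [36496, 52744, 102026, 118274, 167562, 183810, 233092, 262640, 266730, 270826, 274916,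
  278888, 282978, 287074, 295148, 299238, 303334, 311524, 362118, 427654, 4084, 6126, 11906,
  12012, 15880, 18156, 22150, 26246, 38538, 42634, 45284, 55010, 60930, 65890, 69484, 74216,
  78306, 82150, 105988, 110084, 131562, 134788, 138888, 142984, 143714, 147686, 171652, 175748,
  196968, 204290, 208386, 327914, 332132, 336356, 344418, 393450, 397668, 401892, 409954,
  458980])))

theorem cert10_ok : chkCfg [7, 11, 52, 112] [3, 3, 4, 2, 3, 3, 2] cert10 = true := by decide +kernel

def cert11 : Ct :=
  .N 12 (.N 1 (.N 2 (.L [32867, 65633, 66881, 69865, 74121, 98369, 99656, 131169, 131489, 131881,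
  135401, 163873, 164264, 196713]) (.L [13095, 26247, 40995, 41764, 69865, 74121, 99657, 131881,
  135401, 164265])) (.L [225, 801, 1345, 9969, 13092, 13635, 20865, 22151, 24961, 26247, 38215,
  41767, 67443, 69865, 74121, 99657, 131305, 136513, 135560, 151937, 164649])) (.N 8 (.L [16659,
  225, 1765, 5765, 5868, 9003, 12547, 13636, 20737, 21288, 25929, 38215, 66881, 69865, 73985,
  75080, 82721, 87681, 90369, 131297, 135400, 135425, 140935, 151809, 164649, 202369]) (.N 18 (.L
  [225, 801, 1345, 1956, 5444, 6061, 13639, 17907, 21289, 25929, 37095, 41188, 41537, 70209,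
  71303, 99975, 115265, 131304, 135393, 135752, 164649, 201281]) (.N 9 (.L [225, 1345, 5873,
  10193, 13095, 16673, 21289, 25929, 41251, 41764, 69865, 87681, 99657, 116353, 135401, 140935,
  147753, 164649]) (.L [2043, 4321, 5444, 5764, 5864, 8995, 10190, 13095, 17395, 21289, 25929,
  41191, 67443, 69864, 70433, 83883, 87681, 90337, 99656, 99969, 116353, 132595, 135394, 136519,
  139489, 140609, 140935, 147685, 148262, 153217, 155873, 164647, 165506, 181889, 196841, 197410,
  202369, 206145, 214339, 231041]))))

theorem cert11_ok : chkCfg [7, 25, 42, 52] [5, 5, 4, 5, 4, 4, 0] cert11 = true := by decide +kernel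

def cert12 : Ct :=
  .N 48 (.N 8 (.N 2 (.N 5 (.L [4418, 13638, 16706, 18250, 25926, 50692, 65764, 67970, 76168,
  79362, 82246, 83522, 131300, 133506, 137608, 164006, 262370, 262946, 263910, 263974, 267590,
  267842, 268002, 272034, 274692, 284164, 288260, 295784, 300354, 304450, 329580, 332006, 337222,
  360514, 393442, 397540, 397570, 462914]) (.L [4418, 13638, 16706, 17186, 18216, 25926, 39300,
  49956, 65764, 67970, 76168, 79362, 82244, 83268, 87554, 90370, 131300, 133506, 137608, 149058,
  149252, 148258, 151810, 157442, 213316, 262370, 262946, 263910, 263974, 267590, 267842, 268002,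
  272098, 274692, 284164, 288260, 295784, 300354, 304450, 329580, 332006, 337222, 360514, 393442,
  397540, 397570, 462914])) (.L [5446, 12546, 13092, 18218, 18242, 20738, 21284, 24834, 25924,
  39300, 43396, 49954, 50690, 65764, 67970, 76168, 78082, 83272, 87554, 90370, 131300, 133506,
  137608, 144898, 148802, 149250, 151810, 157186, 262946, 263910, 263974, 264002, 267590, 268004,
  270562, 271144, 274692, 284164, 288260, 300354, 304450, 329580, 332006, 336130, 337220, 393442,
  397540, 397570])) (.N 72 (.N 5 (.N 6 (.L [5446, 7490, 13094, 37060, 41124, 50692, 65764, 67970,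
  76584, 79362, 84424, 98502, 131300, 133506, 137474, 138566, 149928, 164006, 262370, 267978,
  276740, 284164, 288260, 331974, 338178, 397510]) (.L [5446, 7490, 10628, 11044, 13094, 17732,
  18248, 37092, 41124, 50692, 65764, 67970, 76034, 76580, 76162, 79362, 83266, 91650, 131300,
  133506, 137474, 138566, 149928, 156994, 164006, 262370, 268010, 276740, 284164, 288260, 332006,
  338310, 397542])) (.N 22 (.L [1512, 5444, 5604, 6530, 7490, 10628, 13094, 18218, 25926, 37092,
  41188, 50692, 76584, 79362, 82726, 84226, 87554, 99014, 131300, 133506, 138566, 137602, 144706,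
  153858, 262370, 267978, 276740, 284164, 288260, 301442, 332006, 338178, 393446, 399618, 399748])
  (.L [1000, 1508, 5092, 5444, 6530, 7490, 8996, 9704, 13090, 14596, 17190, 18212, 18242, 25926,
  37092, 41188, 50692, 65764, 67970, 76034, 76580, 76162, 79362, 83272, 87554, 131300, 133506,
  138566, 137602, 144706, 148262, 153858, 157186, 262370, 268010, 272772, 271140, 275972, 284164,
  288260, 301442, 332006, 338310, 393446, 399618, 399748]))) (.N 24 (.L [1510, 2536, 5446, 5606,
  10628, 13062, 18218, 18242, 21254, 25350, 39300, 41188, 49380, 65764, 76168, 79362, 83272,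
  87554, 91650, 133614, 137608, 141704, 143586, 148806, 149890, 151778, 213764, 262370, 263490,
  263910, 263974, 268770, 267592, 271144, 272098, 275972, 280290, 284164, 288260, 299778, 303874,
  329580, 332006, 337222, 397542]) (.N 65 (.L [996, 5096, 5444, 9708, 13094, 18218, 18242, 21286,
  25926, 37092, 43044, 50692, 65764, 67970, 76584, 79362, 83272, 87554, 92546, 131300, 133506,
  137608, 141704, 144706, 157186, 165922, 206884, 215076, 264006, 272772, 288260, 304450, 332006,
  338310, 397542]) (.L [996, 2536, 2980, 5096, 5444, 9708, 13094, 18218, 18242, 21286, 25926,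
  39300, 43396, 50692, 68078, 69860, 72068, 76168, 79362, 83272, 87554, 91650, 133614, 137608,
  141704, 144706, 147684, 149890, 262370, 262946, 263974, 272866, 271144, 275972, 280298, 284164,
  288260, 300354, 304450, 329580, 332006, 337222, 346498, 393446, 398662]))))) (.N 16 (.N 20 (.L
  [131598, 1508, 3566, 5444, 5608, 8994, 10628, 10722, 11716, 13092, 13634, 18914, 25926, 32996,
  35302, 39300, 41604, 49380, 76168, 137608, 139492, 141700, 143874, 148264, 152066, 156162,
  164484, 166786, 201508, 205028, 213220, 230306, 266466, 267592, 271144, 271682, 299522, 303618,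
  329580, 332006, 337222, 394156, 397538, 397956, 402052, 402146, 409828, 412034, 426788, 458982,
  461186, 463650, 467170, 477570]) (.L [16908, 131598, 1508, 3566, 5444, 5608, 8994, 10628, 10722,
  11716, 13092, 13634, 21286, 25926, 32994, 35304, 39300, 41188, 49378, 51010, 76168, 91458,
  135908, 137604, 139492, 141700, 143874, 148264, 152066, 156162, 166790, 201508, 205028, 214340,
  232354, 266466, 267592, 271144, 271682, 299522, 303618, 329580, 332006, 337222, 394018, 396202,
  397538, 399748, 401636, 412034, 426788, 458984, 463074])) (.N 8 (.N 84 (.L [5446, 8994, 12546,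
  13092, 17186, 17730, 20738, 21284, 24834, 25924, 39300, 43396, 69860, 76168, 83272, 91458,
  99652, 131300, 133866, 137608, 141956, 148264, 152354, 166534, 200930, 200962, 205028, 213252,
  230178, 266466, 267592, 271144, 271682, 274692, 299810, 329580, 336130, 337220, 361794, 396204,
  397538, 397570, 400002, 401636, 409858, 459558, 465538]) (.L [5446, 8994, 12546, 13092, 17186,
  17730, 20738, 21284, 24834, 25924, 39300, 43396, 69860, 76168, 83272, 91458, 99652, 101826,
  131300, 131876, 133506, 134050, 137608, 148264, 152354, 200932, 205028, 213252, 231810, 264042,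
  266466, 267592, 271144, 271682, 274692, 299810, 330114, 329026, 329570, 331206, 332006, 336130,
  337220, 363972, 394018, 396202, 397540, 397570, 401634, 426788, 458982, 461186, 463074, 467170,
  475394])) (.N 1 (.N 100 (.L [10626, 13094, 21286, 25926, 37092, 40994, 43394, 49380, 69858,
  72934, 76168, 81026, 83272, 86242, 91458, 101510, 131300, 131876, 148264, 152354, 200932,
  204834, 206146, 213026, 213218, 230722, 263490, 270562, 271144, 296296, 299810, 303138, 329068,
  332006, 337222, 346498, 347300, 363972, 398118, 426018, 462280, 463074, 466978]) (.L [10628,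
  13094, 21286, 25926, 37092, 40994, 41186, 49186, 49378, 69860, 76168, 83272, 91458, 101830,
  131300, 131876, 133506, 134052, 137608, 141704, 148264, 152354, 200932, 206148, 213220, 231810,
  263490, 270562, 271144, 296296, 299810, 303138, 329068, 332006, 337222, 345414, 362882, 394020,
  396200, 397542, 426018, 426786, 458984, 463074, 466978, 475170])) (.N 97 (.L [2032, 2978, 9196,
  13094, 17900, 21286, 25926, 39300, 43396, 49380, 69858, 72070, 76168, 81122, 83272, 86242,
  91458, 99652, 100738, 131300, 132970, 136518, 135970, 141704, 148264, 152354, 164642, 166946,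
  166274, 200932, 205028, 216100, 231810, 262370, 263150, 268778, 271144, 271682, 299810, 331212,
  332006, 337222, 458984, 470050, 477570]) (.L [4082, 9196, 13094, 17900, 21286, 25926, 38212,
  41188, 49380, 71144, 76168, 78050, 83272, 86242, 91458, 100198, 131874, 133612, 137608, 139490,
  140068, 140258, 144706, 148264, 152354, 155874, 164838, 200930, 201506, 206148, 213220, 232898,
  262370, 263150, 268774, 267588, 271144, 271682, 275780, 281060, 279334, 285060, 289156, 297890,
  298436, 296802, 299810, 306626, 312642, 330114, 329578, 332006, 337222, 345414, 363972, 394018,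
  396202, 401638, 412034, 411106, 410402, 426788, 458982, 461186, 463074, 467170, 477570])))))

theorem cert12_ok : chkCfg [7, 25, 42, 76] [3, 3, 3, 4, 2, 2, 1] cert12 = true := by decide +kernel

def cert13 : Ct :=
  .N 1 (.N 97 (.N 6 (.N 40 (.N 10 (.L [21288, 35460, 52264, 66884, 67018, 69830, 76840, 83204,
  98502, 131298, 148268, 152836, 158342, 196802, 196840, 200898, 204836, 213028, 262370, 262594,
  262950, 266698, 271148, 274756, 288006, 311332, 328002, 329032, 334882, 335908, 360770, 460034])
  (.L [13096, 21288, 35460, 35530, 37062, 52264, 66884, 67018, 69830, 76840, 83204, 98502, 131298,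
  148268, 152836, 158342, 196842, 203810, 204836, 213028, 262370, 262950, 271148, 288006, 295146,
  303140, 311332, 328962, 329032, 335908])) (.L [13096, 21288, 35460, 35530, 37062, 52264, 66884,
  67018, 69830, 76840, 98502, 131298, 131878, 148268, 158342, 171042, 180260, 196802, 196840,
  200898, 204836, 213028, 232066, 262370, 262950, 271148, 288070, 295106, 295144, 299202, 303140,
  311332, 330786, 329032, 335908, 428678])) (.N 4 (.L [8336, 13096, 35460, 37094, 43656, 52264,
  60034, 66884, 67018, 69862, 76840, 92802, 131878, 148268, 158342, 166946, 166536, 180260,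
  196842, 204836, 213028, 262950, 271148, 288070, 295146, 303140, 311332, 329032, 335908]) (.L
  [10882, 13096, 21288, 36814, 37094, 43656, 52264, 58690, 66884, 69862, 76840, 83272, 91458,
  100996, 131878, 148268, 158342, 166946, 166536, 180260, 196842, 203810, 204836, 213028, 262950,
  271148, 288070, 295146, 303140, 311332, 329032, 335908]))) (.N 64 (.L [133170, 137226, 393262,
  10882, 13096, 17730, 21288, 35460, 37094, 43656, 59394, 66884, 69862, 77128, 83272, 91458,
  141996, 143586, 148268, 154404, 157734, 166698, 169986, 180260, 196842, 202754, 204836, 213028,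
  231426, 271148, 288070, 295146, 303140, 311332, 335908, 404102, 404130, 412328, 428678, 461734])
  (.L [393262, 10882, 13096, 17730, 21288, 36814, 37094, 43656, 51844, 60034, 66884, 69862, 83272,
  91458, 131298, 134064, 135974, 137860, 141996, 148268, 158342, 166536, 180260, 196842, 203490,
  204836, 213028, 268138, 271148, 276324, 279916, 282850, 283970, 288070, 295146, 300898, 303140,
  311332, 328482, 329032, 332578, 335908, 360482, 402792, 409828, 412324, 417826, 426018, 426788,
  459558]))) (.N 16 (.N 18 (.N 8 (.N 33 (.L [17222, 21256, 26442, 58690, 72324, 134024, 148268,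
  151812, 158342, 180740, 214052, 262370, 264048, 266730, 271148, 274692, 279878, 282884, 287782,
  296490, 300066, 303620, 328738, 329320, 332354, 361794, 393710, 402728, 410920, 426566]) (.L
  [13636, 17222, 21256, 26442, 58690, 72324, 131298, 134064, 142060, 143876, 148268, 151812,
  158342, 164646, 166532, 180740, 196842, 203394, 207586, 213570, 262370, 264048, 266722, 266818,
  267590, 271148, 274692, 279016, 279874, 282884, 286978, 288068, 295718, 295492, 300354, 332354,
  393710, 397570, 397826, 397890, 402184, 409828, 410372, 418018, 426790, 459010, 459556])) (.L
  [13636, 18250, 21288, 26090, 37094, 43656, 49734, 50498, 60034, 131298, 134064, 135906, 137864,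
  142060, 143876, 148268, 152068, 158342, 166536, 180740, 196836, 197414, 203458, 205028, 213570,
  262370, 264048, 267592, 271148, 274948, 283140, 288070, 295146, 303620, 311812, 328486, 394734,
  397826, 397892, 403272, 409830, 426498, 426788, 459558])) (.L [8720, 13096, 17730, 18250, 21288,
  26090, 32994, 37092, 38210, 43656, 57858, 92802, 131298, 134064, 135906, 137864, 142060, 143876,
  148268, 152068, 156162, 158340, 166536, 169282, 180740, 196836, 197414, 203490, 205028, 262370,
  264048, 267592, 271148, 274948, 283140, 288070, 295146, 303620, 311812, 328486, 394734, 397540,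
  397826, 403272, 409826, 418306, 426498, 426788, 459558])) (.N 8 (.N 4 (.L [10882, 13096, 23172,
  27530, 69862, 74118, 75202, 83270, 91458, 99650, 131298, 134064, 137864, 137954, 142060, 143620,
  148268, 151812, 158342, 164646, 196842, 200834, 204930, 205058, 213252, 262370, 264048, 266724,
  267590, 271148, 274692, 279014, 282884, 288070, 295718, 300354, 303234, 329032, 336132, 393710,
  397540, 397570, 401634, 412552, 426790, 459010, 459556]) (.L [10882, 11146, 13096, 21286, 23170,
  27370, 49954, 58690, 69862, 83272, 91458, 131298, 134064, 137864, 137954, 142060, 143620,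
  148268, 151812, 158342, 164646, 196842, 205060, 213252, 262370, 264048, 266724, 267590, 271148,
  274692, 279014, 282884, 288070, 295718, 300354, 329032, 334466, 336132, 393710, 397542, 412552,
  426790, 459010, 459556])) (.N 65 (.L [802, 1006, 2022, 10882, 12238, 13096, 17730, 21288, 26090,
  37094, 43656, 51844, 60034, 69862, 75076, 83272, 91458, 131878, 132076, 138026, 140076, 144708,
  148268, 151778, 157734, 166570, 170018, 182308, 196842, 202786, 206884, 232066, 271148, 288070,
  295146, 305188, 313380, 329032, 337956, 396014, 400294, 404102, 412328, 428678]) (.N 66 (.L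
  [1006, 1890, 8996, 13092, 15684, 21288, 26090, 37092, 38978, 43656, 49378, 51266, 58690, 69862,
  77128, 83272, 91458, 99106, 100420, 132082, 137860, 138150, 139490, 140074, 144708, 148268,
  154244, 157926, 164642, 166536, 168738, 183204, 196842, 201506, 206148, 215108, 262950, 275780,
  279340, 285316, 288070, 295146, 301122, 313988, 333890, 363202, 396014, 400294, 426790, 461506,
  459556]) (.L [4086, 9198, 10882, 13096, 17730, 20430, 21288, 26090, 30562, 37094, 43656, 52130,
  51942, 60034, 69862, 75234, 76518, 83272, 91458, 99106, 99650, 101090, 131298, 131874, 132076,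
  134050, 137864, 137954, 140074, 142050, 144708, 148268, 154340, 158342, 166530, 166824, 168738,
  172834, 173026, 182916, 196842, 201506, 206146, 207586, 215780, 232066, 263146, 264040, 275236,
  278754, 279338, 285316, 288070, 295146, 300354, 303908, 313988, 328482, 329032, 332578, 336676,
  344292, 361250, 394730, 394020, 398662, 402216, 409830, 411106, 419298, 428966, 459558])))))

theorem cert13_ok : chkCfg [7, 25, 42, 84] [4, 3, 3, 4, 4, 2, 2] cert13 = true := by decide +kernel

theorem frankl_of_cfgs {α : Type*} [DecidableEq α] {F : Finset (Finset α)} (huc : unionClosed F)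
    {X : Finset α} {c : List ℕ} (hc : c ∈ cfgs) (h : Rlz X F c) : frankl F := by
  obtain ⟨e, h1, h2, h3⟩ := h
  have key : ∃ ws t, chkCfg c ws t = true := by
    simp only [cfgs, List.mem_cons, List.not_mem_nil, or_false] at hc
    rcases hc with rfl | rfl | rfl | rfl | rfl | rfl | rfl | rfl | rfl | rfl | rfl | rfl | rfl | rfl
    · exact ⟨_, _, cert0_ok⟩
    · exact ⟨_, _, cert1_ok⟩
    · exact ⟨_, _, cert2_ok⟩
    · exact ⟨_, _, cert3_ok⟩
    · exact ⟨_, _, cert4_ok⟩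
    · exact ⟨_, _, cert5_ok⟩
    · exact ⟨_, _, cert6_ok⟩
    · exact ⟨_, _, cert7_ok⟩
    · exact ⟨_, _, cert8_ok⟩
    · exact ⟨_, _, cert9_ok⟩
    · exact ⟨_, _, cert10_ok⟩
    · exact ⟨_, _, cert11_ok⟩
    · exact ⟨_, _, cert12_ok⟩
    · exact ⟨_, _, cert13_ok⟩
  have hne : c ≠ [] := by
    rintro rfl
    revert hc
    decide
  obtain ⟨ws, t, hk⟩ := key
  exact frankl_of_cfg c ws t hk hne F huc X e h1 h2 h3

theorem last_step {α : Type*} [DecidableEq α] {F : Finset (Finset α)} (huc : unionClosed F)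
    {X : Finset α} {S : Finset (Finset α)} {B : Finset α} {L : List ℕ} (hL : L ∈ lev3)
    (hR : Rlz X S L) (hB : B ⊆ X) (hc : B.card = 3) (hBS : B ∉ S) (hF : insert B S ⊆ F) :
    frankl F := by
  have hSF : S ⊆ F := (Finset.subset_insert _ _).trans hF
  have go : ∀ {tab : List ℕ}, chkStep L cfgs tab = true → frankl F := by
    intro tab ht
    obtain ⟨c, hcc, hr⟩ := step ht hR hB hc hBS
    exact frankl_of_cfgs huc hcc (hr.mono hF)
  have direct : L ∈ cfgs → frankl F := fun h => frankl_of_cfgs huc h (hR.mono hSF)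
  simp only [lev3, List.mem_cons, List.not_mem_nil, or_false] at hL
  rcases hL with rfl | rfl | rfl | rfl | rfl | rfl | rfl | rfl | rfl | rfl
  · exact direct (by decide)
  · exact direct (by decide)
  · exact direct (by decide)
  · exact direct (by decide)
  · exact go tab5_ok
  · exact go tab6_ok
  · exact go tab7_ok
  · exact go tab8_ok
  · exact go tab9_ok
  · exact go tab10_ok

end FC734

theorem uniform_734_fc_family {α : Type*} [DecidableEq α] (F : Finset (Finset α))
    (huc : unionClosed F) (A₁ A₂ A₃ A₄ : Finset α)
    (h₁ : A₁ ∈ F) (h₂ : A₂ ∈ F) (h₃ : A₃ ∈ F) (h₄ : A₄ ∈ F)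
    (hne₁₂ : A₁ ≠ A₂) (hne₁₃ : A₁ ≠ A₃) (hne₁₄ : A₁ ≠ A₄)
    (hne₂₃ : A₂ ≠ A₃) (hne₂₄ : A₂ ≠ A₄) (hne₃₄ : A₃ ≠ A₄)
    (hc₁ : A₁.card = 3) (hc₂ : A₂.card = 3) (hc₃ : A₃.card = 3) (hc₄ : A₄.card = 3)
    (hu : (A₁ ∪ A₂ ∪ A₃ ∪ A₄).card ≤ 7) :
    frankl F := by
  obtain ⟨X, hX⟩ : ∃ X, X = A₁ ∪ A₂ ∪ A₃ ∪ A₄ := ⟨_, rfl⟩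
  rw [← hX] at hu
  have s1 : A₁ ⊆ X := by rw [hX]; intro a ha; simp [ha]
  have s2 : A₂ ⊆ X := by rw [hX]; intro a ha; simp [ha]
  have s3 : A₃ ⊆ X := by rw [hX]; intro a ha; simp [ha]
  have s4 : A₄ ⊆ X := by rw [hX]; intro a ha; simp [ha]
  have r0 : FC734.Rlz X (∅ : Finset (Finset α)) [] := by
    refine ⟨fun a => if h : a ∈ X then (X.equivFin ⟨a, h⟩ : ℕ) else 0, ?_, ?_, by simp⟩
    · intro a ha b hb hab
      have ha' : a ∈ X := ha
      have hb' : b ∈ X := hb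
      simp only [ha', hb', dif_pos] at hab
      have := X.equivFin.injective (Fin.ext hab)
      exact congrArg Subtype.val this
    · intro a ha
      simp only [ha, dif_pos]
      exact lt_of_lt_of_le (X.equivFin ⟨a, ha⟩).2 hu
  obtain ⟨L1, hL1, r1⟩ := FC734.step FC734.tab0_ok r0 s1 hc₁ (by simp)
  simp only [FC734.lev1, List.mem_cons, List.not_mem_nil, or_false] at hL1
  subst hL1
  obtain ⟨L2, hL2, r2⟩ := FC734.step FC734.tab1_ok r1 s2 hc₂ (by simpa using hne₁₂.symm)
  have n3 : A₃ ∉ insert A₂ (insert A₁ (∅ : Finset (Finset α))) := by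
    simp [hne₁₃.symm, hne₂₃.symm]
  have r3 : ∃ L3 ∈ FC734.lev3, FC734.Rlz X (insert A₃ (insert A₂ (insert A₁ ∅))) L3 := by
    simp only [FC734.lev2, List.mem_cons, List.not_mem_nil, or_false] at hL2
    rcases hL2 with rfl | rfl | rfl
    · exact FC734.step FC734.tab2_ok r2 s3 hc₃ n3
    · exact FC734.step FC734.tab3_ok r2 s3 hc₃ n3
    · exact FC734.step FC734.tab4_ok r2 s3 hc₃ n3
  obtain ⟨L3, hL3, r3⟩ := r3
  refine FC734.last_step huc hL3 r3 s4 hc₄ ?_ ?_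
  · simp [hne₁₄.symm, hne₂₄.symm, hne₃₄.symm]
  · intro A hA
    simp only [Finset.mem_insert, Finset.notMem_empty, or_false] at hA
    rcases hA with rfl | rfl | rfl | rfl <;> assumption
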